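/- Let (α_k) be a sequence in {A,B}, (i_k) an α_k-admissible sequence of index data, and (β_k) an α_k-admissible sequence of letters such that β_k = α_k for infinitely many k. Then the vertex coloring of the d-regular tree T defined by the direct limit (Y,φ) = lim_→ F^{β_k}_k (via pulling back the coloring of Y along the universal covering T → Y) is a Sturmian coloring. -/

import Mathlib

open scoped Classical

noncomputable section

namespace Sturm

variable {V α : Type}

/-- `G` is a `d`-regular tree. -/
structure IsRegularTree (G : SimpleGraph V) (d : ℕ) : Prop where
  isTree : G.IsTree
  regular : ∀ v : V, (G.neighborSet v).ncard = d

/-- Color-preserving isomorphism of the `n`-balls centered at `x` and `y`,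
sending center to center. -/
def BallEquiv (G : SimpleGraph V) (φ : V → α) (n : ℕ) (x y : V) : Prop :=
  ∃ f : {z : V // G.dist x z ≤ n} ≃ {z : V // G.dist y z ≤ n},
    (∀ u v : {z : V // G.dist x z ≤ n}, G.Adj u.1 v.1 ↔ G.Adj (f u).1 (f v).1) ∧
    (∀ u : {z : V // G.dist x z ≤ n}, φ (f u).1 = φ u.1) ∧
    ((f ⟨x, by rw [SimpleGraph.dist_self]; exact Nat.zero_le n⟩).1 = y)

/-- The class of the `n`-ball at `x`, viewed as the set of all centers of equivalent balls. -/
def ballClass (G : SimpleGraph V) (φ : V → α) (n : ℕ) (x : V) : Set V :=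
  {y | BallEquiv G φ n x y}

/-- The set `B_n(φ)` of classes of `n`-balls occurring in `(T, φ)`. -/
def ballClasses (G : SimpleGraph V) (φ : V → α) (n : ℕ) : Set (Set V) :=
  {C | ∃ x, C = ballClass G φ n x}

/-- A coloring is Sturmian if its factor complexity is `n + 2`. -/
def IsSturmian (G : SimpleGraph V) (φ : V → α) : Prop :=
  ∀ n, (ballClasses G φ n).ncard = n + 2

/-- `x` is the center of a special `n`-ball. -/
def IsSpecialVert (G : SimpleGraph V) (φ : V → α) (n : ℕ) (x : V) : Prop :=
  ∃ y, BallEquiv G φ n x y ∧ ¬ BallEquiv G φ (n + 1) x y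

/-- `S` is a special class of `n`-balls: the restriction of two distinct classes of
`(n+1)`-balls. -/
def IsSpecialClass (G : SimpleGraph V) (φ : V → α) (n : ℕ) (S : Set V) : Prop :=
  ∃ x, S = ballClass G φ n x ∧ IsSpecialVert G φ n x

/-- The class `D` is always adjacent to the class `E`. -/
def AlwaysAdjTo (G : SimpleGraph V) (D E : Set V) : Prop :=
  ∀ x ∈ D, ∃ y, G.Adj x y ∧ y ∈ E

/-- The classes `D` and `E` are (always) adjacent. -/
def AlwaysAdj (G : SimpleGraph V) (D E : Set V) : Prop :=
  AlwaysAdjTo G D E ∧ AlwaysAdjTo G E D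

/-- The classes `D` and `E` can be adjacent. -/
def CanAdj (G : SimpleGraph V) (D E : Set V) : Prop :=
  ∃ x ∈ D, ∃ y ∈ E, G.Adj x y

/-- The number of neighbors of `x` lying in (i.e. being centers of balls of class) `E`. -/
def nbrCount (G : SimpleGraph V) (x : V) (E : Set V) : ℕ :=
  (G.neighborSet x ∩ E).ncard

/-- The data of the labels `S_n, C_n, A_n, B_n` for a Sturmian coloring, normalized as in
the paper: `S_0 = A_0 = [a]`, `B_0 = [b]`, `A_{n+1}` (resp. `B_{n+1}`) is always adjacent
to `A_n` (resp. `B_n`), and `A_{n+1}, B_{n+1}` are the two distinct extensions of `S_n`. -/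
structure Labeling (G : SimpleGraph V) (φ : V → α) (a b : α) where
  S : ℕ → Set V
  C : ℕ → Set V
  A : ℕ → Set V
  B : ℕ → Set V
  S_special : ∀ n, IsSpecialClass G φ n (S n)
  C_central : ∀ n, ∃ x, IsSpecialVert G φ (n + 1) x ∧ S (n + 1) = ballClass G φ (n + 1) x ∧
      C n = ballClass G φ n x
  A0_eq_S0 : A 0 = S 0
  A0_col : ∃ x, φ x = a ∧ A 0 = ballClass G φ 0 x
  B0_col : ∃ x, φ x = b ∧ B 0 = ballClass G φ 0 x
  A_ext : ∀ n, ∃ x, IsSpecialVert G φ n x ∧ S n = ballClass G φ n x ∧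
      A (n + 1) = ballClass G φ (n + 1) x
  B_ext : ∀ n, ∃ x, IsSpecialVert G φ n x ∧ S n = ballClass G φ n x ∧
      B (n + 1) = ballClass G φ (n + 1) x
  AB_ne : ∀ n, A (n + 1) ≠ B (n + 1)
  A_adj : ∀ n, AlwaysAdjTo G (A (n + 1)) (A n)
  B_adj : ∀ n, AlwaysAdjTo G (B (n + 1)) (B n)

/-- A cycle (of length `≥ 3`, with pairwise distinct vertices) in the graph `G_n` of
classes of `n`-balls, where classes are joined when they can be adjacent. -/
def IsCycleIn (G : SimpleGraph V) (φ : V → α) (n k : ℕ) (c : ℕ → Set V) : Prop :=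
  3 ≤ k ∧ (∀ i < k, c i ∈ ballClasses G φ n) ∧
    (∀ i < k, CanAdj G (c i) (c ((i + 1) % k))) ∧
    (∀ i < k, ∀ j < k, c i = c j → i = j)

/-- The graph `G_n` contains a cycle. -/
def HasCycle (G : SimpleGraph V) (φ : V → α) (n : ℕ) : Prop :=
  ∃ k c, IsCycleIn G φ n k c

/-! ## Edge-indexed colored graphs -/

/-- An edge-indexed graph, with vertices colored by `α` and labeled by classes
(sets of vertices of the underlying tree `V`). Index `0` means "no edge". -/
structure EIG (V α : Type) where
  Vert : Type
  idx : Vert → Vert → ℕ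
  col : Vert → α
  lab : Vert → Set V

/-- Isomorphism of colored edge-indexed graphs. -/
structure EIGIso (X Y : EIG V α) where
  e : X.Vert ≃ Y.Vert
  idx_eq : ∀ u v, Y.idx (e u) (e v) = X.idx u v
  col_eq : ∀ u, Y.col (e u) = X.col u

/-- The index `i_A(D, E)` (resp. `i_B`, `i`) at the level of classes: the number of
neighbors, in class `E`, of a representative center of `D`; when `D` is the special
class `Sp`, the representative is taken with extension of class `Ext`. -/
def classIdx (G : SimpleGraph V) (Sp Ext : Set V) (D E : Set V) : ℕ :=
  if D = Sp then (if h : Ext.Nonempty then nbrCount G h.some E else 0)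
  else (if h : D.Nonempty then nbrCount G h.some E else 0)

/-- The classes of `n`-balls joined to `Sp` by a path of edges of positive `J`-index. -/
def reachSet (G : SimpleGraph V) (φ : V → α) (n : ℕ) (Sp : Set V)
    (J : Set V → Set V → ℕ) : Set (Set V) :=
  {D | ∃ k, ∃ c : ℕ → Set V, c 0 = Sp ∧ c k = D ∧ (∀ i ≤ k, c i ∈ ballClasses G φ n) ∧
    ∀ i < k, 0 < J (c i) (c (i + 1)) ∨ 0 < J (c (i + 1)) (c i)}

/-- Color of a class: the color of (the center of) any of its representatives. -/
def colOf [Nonempty V] (φ : V → α) (D : Set V) : α :=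
  if h : D.Nonempty then φ h.some else φ (Classical.arbitrary V)

/-- The edge-indexed graph `G^A_n` (when `Ext = A_{n+1}`) resp. `G^B_n`. -/
def sideEIG [Nonempty V] (G : SimpleGraph V) (φ : V → α) (n : ℕ) (Sp Ext : Set V) :
    EIG V α where
  Vert := {D : Set V // D ∈ reachSet G φ n Sp (classIdx G Sp Ext)}
  idx := fun D E => classIdx G Sp Ext D.1 E.1
  col := fun D => colOf φ D.1
  lab := fun D => D.1

variable {G : SimpleGraph V} {φ : V → α} {a b : α}

/-- The edge-indexed graph `G^A_n`. -/
def GAeig [Nonempty V] (L : Labeling G φ a b) (n : ℕ) : EIG V α :=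
  sideEIG G φ n (L.S n) (L.A (n + 1))

/-- The edge-indexed graph `G^B_n`. -/
def GBeig [Nonempty V] (L : Labeling G φ a b) (n : ℕ) : EIG V α :=
  sideEIG G φ n (L.S n) (L.B (n + 1))

/-- Vertex set of `G^A_n`. -/
def VGAset (L : Labeling G φ a b) (n : ℕ) : Set (Set V) :=
  reachSet G φ n (L.S n) (classIdx G (L.S n) (L.A (n + 1)))

/-- Vertex set of `G^B_n`. -/
def VGBset (L : Labeling G φ a b) (n : ℕ) : Set (Set V) :=
  reachSet G φ n (L.S n) (classIdx G (L.S n) (L.B (n + 1)))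

/-- `G^A_n` or `G^B_n`, selected by a letter (`true = A`, `false = B`). -/
def GsideEIG [Nonempty V] (L : Labeling G φ a b) (n : ℕ) : Bool → EIG V α
  | true => GAeig L n
  | false => GBeig L n

/-- Vertex set of `G^A_n` or `G^B_n`, selected by a letter. -/
def VGside (L : Labeling G φ a b) (n : ℕ) : Bool → Set (Set V)
  | true => VGAset L n
  | false => VGBset L n

/-- A single vertex with a loop of index `d` (the graph `G^A_{-1} = G^B_{-1} = F^._{-1}`). -/
def baseEIG (V : Type) (x : α) (d : ℕ) : EIG V α where
  Vert := PUnit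
  idx := fun _ _ => d
  col := fun _ => x
  lab := fun _ => Set.univ

/-- `GAx L d (n+1) = G^A_n`, and `GAx L d 0 = G^A_{-1}`. -/
def GAx [Nonempty V] (L : Labeling G φ a b) (d : ℕ) : ℕ → EIG V α
  | 0 => baseEIG V a d
  | n + 1 => GAeig L n

/-- `GBx L d (n+1) = G^B_n`, and `GBx L d 0 = G^B_{-1}`. -/
def GBx [Nonempty V] (L : Labeling G φ a b) (d : ℕ) : ℕ → EIG V α
  | 0 => baseEIG V b d
  | n + 1 => GBeig L n

/-- `Cx L (n+1) = C_n`, and `Cx L 0 = C_{-1}` (the class of the empty ball). -/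
def Cx (L : Labeling G φ a b) : ℕ → Set V
  | 0 => Set.univ
  | n + 1 => L.C n

/-! ## Concatenations -/

/-- The `(i)`-concatenation of two edge-indexed graphs at the end vertices `v, v'`
(which are identified). -/
def concatI (X Y : EIG V α) (v : X.Vert) (v' : Y.Vert) (i : ℕ) : EIG V α where
  Vert := X.Vert ⊕ {w : Y.Vert // w ≠ v'}
  idx := fun p q =>
    match p, q with
    | Sum.inl u, Sum.inl w =>
        if u = v ∧ w ≠ v then (if X.idx u w = 0 then 0 else i) else X.idx u w
    | Sum.inl u, Sum.inr w => if u = v then Y.idx v' w.1 - i else 0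
    | Sum.inr w, Sum.inl u => if u = v then Y.idx w.1 v' else 0
    | Sum.inr w, Sum.inr w2 => Y.idx w.1 w2.1
  col := Sum.elim X.col (fun w => Y.col w.1)
  lab := Sum.elim X.lab (fun w => Y.lab w.1)

/-- The `(i,j)`-concatenation of two edge-indexed graphs at the end vertices `v, v'`
(which stay distinct, joined by a new edge of indices `i`, `j`). -/
def concatIJ (X Y : EIG V α) (v : X.Vert) (v' : Y.Vert) (i j : ℕ) : EIG V α where
  Vert := X.Vert ⊕ Y.Vert
  idx := fun p q =>
    match p, q with
    | Sum.inl u, Sum.inl w => if u = v ∧ w = v then X.idx v v - i else X.idx u w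
    | Sum.inl u, Sum.inr w => if u = v ∧ w = v' then i else 0
    | Sum.inr w, Sum.inl u => if w = v' ∧ u = v then j else 0
    | Sum.inr u, Sum.inr w => if u = v' ∧ w = v' then Y.idx v' v' - j else Y.idx u w
  col := Sum.elim X.col Y.col
  lab := Sum.elim X.lab Y.lab

/-- `Z` is a concatenation ((i)- or (i,j)-) of `X` and `Y` at `(vX, vY)`. -/
def IsConcatOfAt (Z X Y : EIG V α) (vX : X.Vert) (vY : Y.Vert) : Prop :=
  (∃ i, 1 ≤ i ∧ Nonempty (EIGIso Z (concatI X Y vX vY i))) ∨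
  (∃ i j, 1 ≤ i ∧ 1 ≤ j ∧ Nonempty (EIGIso Z (concatIJ X Y vX vY i j)))

/-! ## Paths, distance, degree in edge-indexed graphs -/

/-- Adjacency (by an edge of positive index, in one of the two orientations). -/
def EIGAdj (X : EIG V α) (u w : X.Vert) : Prop :=
  u ≠ w ∧ (0 < X.idx u w ∨ 0 < X.idx w u)

/-- There is a path of length `L` from `u` to `w`. -/
def EIGReach (X : EIG V α) (u w : X.Vert) (L : ℕ) : Prop :=
  ∃ c : ℕ → X.Vert, c 0 = u ∧ c L = w ∧ ∀ i < L, EIGAdj X (c i) (c (i + 1))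

/-- Graph distance in an edge-indexed graph. -/
def EIGDist (X : EIG V α) (u w : X.Vert) : ℕ :=
  sInf {L | EIGReach X u w L}

/-- `u` has degree one: there is exactly one vertex adjacent to it. -/
def EIGEndVert (X : EIG V α) (u : X.Vert) : Prop :=
  ∃! w, EIGAdj X u w

/-! ## Coverings, direct limits, quotient graph, bounded type -/

/-- `p` exhibits the graph `H` as the universal cover of the edge-indexed graph `Y`:
above a vertex mapping to `u`, the number of neighbors above `w` is the index `idx u w`. -/
def IsEIGCover {W : Type} (H : SimpleGraph W) (Y : EIG V α) (p : W → Y.Vert) : Prop :=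
  ∀ x : W, ∀ u : Y.Vert, (H.neighborSet x ∩ p ⁻¹' {u}).ncard = Y.idx (p x) u

/-- `Y` is the direct limit of the system `F` of colored edge-indexed graphs along the
inclusions `ι`. -/
def IsDirLimit (F : ℕ → EIG V α) (ι : ∀ k, (F k).Vert → (F (k + 1)).Vert)
    (Y : EIG V α) : Prop :=
  ∃ j : ∀ k, (F k).Vert → Y.Vert,
    (∀ k v, j (k + 1) (ι k v) = j k v) ∧
    (∀ k, Function.Injective (j k)) ∧
    (∀ y, ∃ k v, j k v = y) ∧
    (∀ k v, Y.col (j k v) = (F k).col v) ∧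
    (∀ y z : Y.Vert, ∃ N, ∀ k, N ≤ k → ∀ v w, j k v = y → j k w = z →
      Y.idx y z = (F k).idx v w)

/-- The coloring `φ` is of bounded type: every vertex has finite type set. -/
def BoundedType (G : SimpleGraph V) (φ : V → α) : Prop :=
  ∀ v : V, {m : ℕ | IsSpecialVert G φ m v}.Finite

/-- Two vertices are related if some color-preserving automorphism maps one to the other. -/
def colorOrbitRel (G : SimpleGraph V) (φ : V → α) (x y : V) : Prop :=
  ∃ g : V ≃ V, (∀ u w, G.Adj u w ↔ G.Adj (g u) (g w)) ∧ (∀ u, φ (g u) = φ u) ∧ g x = y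

/-- The quotient graph `X_φ = G\T` as a colored edge-indexed graph. -/
def quotEIG (G : SimpleGraph V) (φ : V → α) : EIG V α where
  Vert := Quot (colorOrbitRel G φ)
  idx := fun u w => (G.neighborSet u.out ∩ {z | Quot.mk (colorOrbitRel G φ) z = w}).ncard
  col := fun u => φ u.out
  lab := fun u => {z | Quot.mk (colorOrbitRel G φ) z = u}

/-! ## The sequences `n_k`, `α_k`, `β_k` -/

/-- At level `n`, one of `A_n, B_n` is `S_n` or `C_n`. -/
def SpecTouch (L : Labeling G φ a b) (n : ℕ) : Prop :=
  L.A n = L.S n ∨ L.A n = L.C n ∨ L.B n = L.S n ∨ L.B n = L.C n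

/-- `nk` is the increasing enumeration of the levels where `SpecTouch` holds. -/
def IsNkSeq (L : Labeling G φ a b) (nk : ℕ → ℕ) : Prop :=
  StrictMono nk ∧ ∀ n, (∃ k, nk k = n) ↔ SpecTouch L n

/-- `αs` is the sequence `α_k`: `α_K = A`, and for `k ≠ K`, `α_k` is the side whose
graph `G^{α_k}_{n_k}` has more vertices. -/
def IsAlphaSeq (L : Labeling G φ a b) (nk : ℕ → ℕ) (K : ℕ∞) (αs : ℕ → Bool) : Prop :=
  ∀ k : ℕ, ((k : ℕ∞) = K → αs k = true) ∧
    ((k : ℕ∞) ≠ K → (αs k = true ↔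
      (VGside L (nk k) false).ncard < (VGside L (nk k) true).ncard))

/-- The sequence `β_k(t)`: `β_{k-1}(t)` is the letter `ᾱ_k` if the class of the
`n_k`-ball at `t` is a vertex of `G^{ᾱ_k}_{n_k}`, and `α_k` otherwise. -/
def betaOf (L : Labeling G φ a b) (nk : ℕ → ℕ) (αs : ℕ → Bool) (t : V) (k : ℕ) : Bool :=
  if ballClass G φ (nk (k + 1)) t ∈ VGside L (nk (k + 1)) (!(αs (k + 1))) then
    !(αs (k + 1))
  else αs (k + 1)

end Sturm

namespace Sturm

variable {V α : Type}

/-! ## The graphs `F^A_k, F^B_k` built from admissible sequences -/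

/-- Index data for one step of the construction: a single index, a pair, or a triple. -/
inductive IdxData : Type
  | one : ℕ → IdxData
  | two : ℕ → ℕ → IdxData
  | three : ℕ → ℕ → ℕ → IdxData

/-- The `i`-component of an index datum. -/
def IdxData.iOf : IdxData → ℕ
  | .one i => i
  | .two i _ => i
  | .three i _ _ => i

/-- The `j`-component of an index datum. -/
def IdxData.jOf : IdxData → ℕ
  | .one i => i
  | .two _ j => j
  | .three _ _ j => j

/-- `k < K` where `K = min {k | α_k = A}` (with `true = A`). -/
def LtK (αs : ℕ → Bool) (k : ℕ) : Prop := ∀ j ≤ k, αs j = false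

/-- `k = K`. -/
def IsK (αs : ℕ → Bool) (k : ℕ) : Prop := αs k = true ∧ ∀ j < k, αs j = false

/-- `k > K`. -/
def GtK (αs : ℕ → Bool) (k : ℕ) : Prop := ∃ j < k, αs j = true

/-- Base case of the recursion for `(𝔦^A_k, 𝔦^B_k, 𝔦^C_k)` at `k = K`. -/
def frakBase (idat : ℕ → IdxData) (k : ℕ) : ℕ × ℕ × ℕ :=
  match idat k with
  | .two i _ => (i, if k = 0 then 0 else (idat (k - 1)).iOf, (idat 0).jOf)
  | .three i i' _ => (i, i', (idat 0).jOf)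
  | .one i => (i, if k = 0 then 0 else (idat (k - 1)).iOf, (idat 0).jOf)

/-- The sequence `(𝔦^A_k, 𝔦^B_k, 𝔦^C_k)` of indices at the end vertices. -/
def frak (αs : ℕ → Bool) (idat : ℕ → IdxData) : ℕ → ℕ × ℕ × ℕ :=
  fun k =>
    Nat.rec (if αs 0 = true then frakBase idat 0 else (0, 0, 0))
      (fun k p =>
        if IsK αs (k + 1) then frakBase idat (k + 1)
        else if GtK αs (k + 1) then
          (if αs (k + 1) = true then (p.1, p.2.2, p.2.1) else (p.2.2, p.2.1, p.1))
        else (0, 0, 0)) k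

/-- The quantity `𝔦^C_k`. -/
def frakC (αs : ℕ → Bool) (idat : ℕ → IdxData) (k : ℕ) : ℕ := (frak αs idat k).2.2

/-- The sequence of index data `(i_k)` is `α_k`-admissible (Definition 4.1 of the paper). -/
def AdmissibleIdx (d : ℕ) (αs : ℕ → Bool) (idat : ℕ → IdxData) : Prop :=
  ∀ k : ℕ,
    (LtK αs k →
      ∃ i j, idat k = .two i j ∧ 1 ≤ i ∧ i < d ∧ 1 ≤ j ∧
        j ≤ d - (if k = 0 then 0 else (idat (k - 1)).iOf)) ∧
    (IsK αs k →
      ((∃ i i' j, idat k = .three i i' j ∧ 1 ≤ i ∧ i < i' ∧ i' ≤ d ∧ 1 ≤ j ∧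
          j ≤ d - (if k = 0 then 0 else (idat (k - 1)).iOf)) ∨
       (k ≠ 0 ∧ ∃ i j, idat k = .two i j ∧ 1 ≤ i ∧ i ≤ d ∧ 1 ≤ j ∧
          j ≤ d - (idat (k - 1)).iOf))) ∧
    (GtK αs k →
      ((∃ i, idat k = .one i ∧ 1 ≤ i ∧ i < frakC αs idat (k - 1)) ∨
       (∃ i j, idat k = .two i j ∧ 1 ≤ i ∧ i ≤ d - frakC αs idat (k - 1) ∧ 1 ≤ j ∧
          j ≤ d - frakC αs idat (k - 1))))

/-- An edge-indexed graph with two distinguished end vertices: the "common" end vertex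
`c` and the other end vertex `o`. -/
structure PtdEIG (V α : Type) where
  gr : EIG V α
  c : gr.Vert
  o : gr.Vert

/-- The pair `(F^A_k, F^B_k)` (with distinguished end vertices). -/
structure Sys (V α : Type) where
  FA : PtdEIG V α
  FB : PtdEIG V α

/-- Selecting the `A`- or `B`-side of a system. -/
def Fside (S : Sys V α) : Bool → PtdEIG V α
  | true => S.FA
  | false => S.FB

/-- The result of one step of the recursive construction, together with the natural
inclusions of the previous graphs into the new ones. -/
structure StepRes (S : Sys V α) where
  next : Sys V α
  embA : S.FA.gr.Vert → next.FA.gr.Vert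
  embB : S.FB.gr.Vert → next.FB.gr.Vert
  crossAB : S.FA.gr.Vert → next.FB.gr.Vert
  crossBA : S.FB.gr.Vert → next.FA.gr.Vert

/-- A trivial (junk) step. -/
def trivialStep (S : Sys V α) : StepRes S :=
  { next := S, embA := id, embB := id,
    crossAB := fun _ => S.FB.c, crossBA := fun _ => S.FA.c }

/-- One step of the recursive construction of `(F^A_k, F^B_k)` (Definition 4.2). -/
def Fstep (αs : ℕ → Bool) (idat : ℕ → IdxData) (k : ℕ) (S : Sys V α) : StepRes S :=
  if LtK αs k then
    match idat k with
    | .two i j =>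
      { next := { FA := S.FA,
                  FB := ⟨concatIJ S.FA.gr S.FB.gr S.FA.c S.FB.c i j,
                         Sum.inl S.FA.c, Sum.inr S.FB.o⟩ },
        embA := id, embB := Sum.inr, crossAB := Sum.inl, crossBA := fun _ => S.FA.c }
    | _ => trivialStep S
  else if IsK αs k then
    match idat k with
    | .three i i' j =>
      { next := { FA := ⟨concatIJ S.FA.gr S.FB.gr S.FA.c S.FB.c i j,
                         Sum.inr S.FB.o, Sum.inl S.FA.o⟩,
                  FB := ⟨concatIJ S.FA.gr S.FB.gr S.FA.c S.FB.c i' j,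
                         Sum.inr S.FB.o, Sum.inl S.FA.o⟩ },
        embA := Sum.inl, embB := Sum.inr, crossAB := Sum.inl, crossBA := Sum.inr }
    | .two i j =>
      { next := { FA := ⟨concatIJ S.FA.gr S.FB.gr S.FA.c S.FB.c i j,
                         Sum.inr S.FB.o, Sum.inl S.FA.o⟩,
                  FB := ⟨S.FB.gr, S.FB.o, S.FB.c⟩ },
        embA := Sum.inl, embB := id, crossAB := fun _ => S.FB.o, crossBA := Sum.inr }
    | _ => trivialStep S
  else
    if αs k = true then
      match idat k with
      | .one i =>
        { next := { FA := ⟨concatI S.FA.gr S.FB.gr S.FA.c S.FB.c i,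
                           (if h : S.FB.o ≠ S.FB.c then Sum.inr ⟨S.FB.o, h⟩
                            else Sum.inl S.FA.c),
                           Sum.inl S.FA.o⟩,
                    FB := ⟨S.FB.gr, S.FB.o, S.FB.c⟩ },
          embA := Sum.inl, embB := id, crossAB := fun _ => S.FB.o,
          crossBA := fun w => if h : w ≠ S.FB.c then Sum.inr ⟨w, h⟩ else Sum.inl S.FA.c }
      | .two i j =>
        { next := { FA := ⟨concatIJ S.FA.gr S.FB.gr S.FA.c S.FB.c i j,
                           Sum.inr S.FB.o, Sum.inl S.FA.o⟩,
                    FB := ⟨S.FB.gr, S.FB.o, S.FB.c⟩ },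
          embA := Sum.inl, embB := id, crossAB := fun _ => S.FB.o, crossBA := Sum.inr }
      | _ => trivialStep S
    else
      match idat k with
      | .one i =>
        { next := { FA := ⟨S.FA.gr, S.FA.o, S.FA.c⟩,
                    FB := ⟨concatI S.FA.gr S.FB.gr S.FA.c S.FB.c i,
                           Sum.inl S.FA.o,
                           (if h : S.FB.o ≠ S.FB.c then Sum.inr ⟨S.FB.o, h⟩
                            else Sum.inl S.FA.c)⟩ },
          embA := id,
          embB := fun w => if h : w ≠ S.FB.c then Sum.inr ⟨w, h⟩ else Sum.inl S.FA.c,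
          crossAB := Sum.inl, crossBA := fun _ => S.FA.o }
      | .two i j =>
        { next := { FA := ⟨S.FA.gr, S.FA.o, S.FA.c⟩,
                    FB := ⟨concatIJ S.FA.gr S.FB.gr S.FA.c S.FB.c i j,
                           Sum.inl S.FA.o, Sum.inr S.FB.o⟩ },
          embA := id, embB := Sum.inr, crossAB := Sum.inl, crossBA := fun _ => S.FA.o }
      | _ => trivialStep S

/-- The base system `(F^A_{-1}, F^B_{-1})`. -/
def baseSys (V : Type) (a b : α) (d : ℕ) : Sys V α :=
  ⟨⟨baseEIG V a d, PUnit.unit, PUnit.unit⟩, ⟨baseEIG V b d, PUnit.unit, PUnit.unit⟩⟩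

/-- The system `(F^A_k, F^B_k)` (Definition 4.2 of the paper). -/
def Fsys (V α : Type) (a b : α) (d : ℕ) (αs : ℕ → Bool) (idat : ℕ → IdxData) :
    ℕ → Sys V α :=
  fun k =>
    Nat.rec ((Fstep αs idat 0 (baseSys V a b d)).next)
      (fun k S => (Fstep αs idat (k + 1) S).next) k

/-- The inclusion of the `x`-side of `S` into the `y`-side of the next system. -/
def StepRes.sel {S : Sys V α} (st : StepRes S) : ∀ x y : Bool,
    (Fside S x).gr.Vert → (Fside st.next y).gr.Vert
  | true, true => st.embA
  | true, false => st.crossAB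
  | false, true => st.crossBA
  | false, false => st.embB

/-- `β` is `α`-admissible: `β_k = α_k` or `β_{k-1}`. -/
def AdmissibleBeta (αs βs : ℕ → Bool) : Prop :=
  ∀ k, βs (k + 1) = αs (k + 1) ∨ βs (k + 1) = βs k

/-- The graph `F^{β_k}_k`. -/
def Fbeta (V α : Type) (a b : α) (d : ℕ) (αs : ℕ → Bool) (idat : ℕ → IdxData)
    (βs : ℕ → Bool) (k : ℕ) : EIG V α :=
  (Fside (Fsys V α a b d αs idat k) (βs k)).gr

/-- The natural inclusion `F^{β_k}_k ↪ F^{β_{k+1}}_{k+1}`. -/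
def betaEmb (V α : Type) (a b : α) (d : ℕ) (αs : ℕ → Bool) (idat : ℕ → IdxData)
    (βs : ℕ → Bool) (k : ℕ) :
    (Fbeta V α a b d αs idat βs k).Vert → (Fbeta V α a b d αs idat βs (k + 1)).Vert :=
  (Fstep αs idat (k + 1) (Fsys V α a b d αs idat k)).sel (βs k) (βs (k + 1))

end Sturm

namespace Sturm

/-! ## Types of vertices of multigraphs -/

/-- Values of the types of depth `n`: the color together with the multiset of types of depth
`n - 1` of the neighbors. -/
def NbType (α : Type) : ℕ → Type
  | 0 => Unit
  | n + 1 => α × Multiset (NbType α n)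

/-- The type of depth `n` of a vertex, for given multisets of neighbors `nb` and colors `col`. -/
def nbType {α X : Type} (nb : X → Multiset X) (col : X → α) : (n : ℕ) → X → NbType α n
  | 0, _ => ()
  | n + 1, x => (col x, (nb x).map (nbType nb col n))

/-- The truncation of a type. -/
def NbType.trunc {α : Type} : (n : ℕ) → NbType α (n + 1) → NbType α n
  | 0, _ => ()
  | n + 1, t => (t.1, Multiset.map (NbType.trunc n) t.2)

section Types

variable {α X Z : Type} {nb : X → Multiset X} {col : X → α} {nb' : Z → Multiset Z} {col' : Z → α}

theorem trunc_nbType (n : ℕ) (x : X) : (nbType nb col (n + 1) x).trunc n = nbType nb col n x := by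
  induction n generalizing x with
  | zero => rfl
  | succ n ih =>
    change (col x, Multiset.map (NbType.trunc n) ((nb x).map (nbType nb col (n + 1)))) =
      (col x, (nb x).map (nbType nb col n))
    rw [Multiset.map_map]
    congr 2
    exact funext ih

theorem nbType_eq_of_le {m n : ℕ} (h : m ≤ n) {x : X} {z : Z}
    (e : nbType nb col n x = nbType nb' col' n z) : nbType nb col m x = nbType nb' col' m z := by
  induction n, h using Nat.le_induction with
  | base => exact e
  | succ n _ ih =>
    apply ih
    rw [← trunc_nbType, e, trunc_nbType]

theorem nbType_succ_eq {n : ℕ} {x : X} {z : Z} :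
    nbType nb col (n + 1) x = nbType nb' col' (n + 1) z ↔
      col x = col' z ∧ (nb x).map (nbType nb col n) = (nb' z).map (nbType nb' col' n) :=
  Prod.mk_inj

theorem nbType_inj_mono {m n : ℕ} (h : m ≤ n) (hi : Function.Injective (nbType nb col m)) :
    Function.Injective (nbType nb col n) :=
  fun _ _ e => hi (nbType_eq_of_le h e)

/-- If the multisets of neighbors of constant size have infinitely many types, but there are at
most `s + 1` types of depth `s` for arbitrarily large `s`, then there are exactly `n + 1` types of
depth `n`. -/
theorem ncard_range_nbType
    (hup : ∀ n, ∃ s, n ≤ s ∧ (Set.range (nbType nb col s)).Finite ∧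
      (Set.range (nbType nb col s)).ncard ≤ s + 1)
    (hlow : ∀ C, ∃ s, C ≤ (Set.range (nbType nb col s)).ncard) (n : ℕ) :
    (Set.range (nbType nb col n)).ncard = n + 1 := by
  have himg : ∀ n, Set.range (nbType nb col n) =
      NbType.trunc n '' Set.range (nbType nb col (n + 1)) := by
    intro n
    rw [← Set.range_comp]
    congr 1
    exact funext fun x => (trunc_nbType n x).symm
  have hfin' : ∀ s n, n ≤ s → (Set.range (nbType nb col s)).Finite →
      (Set.range (nbType nb col n)).Finite := by
    intro s n h
    induction s, h using Nat.le_induction with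
    | base => exact id
    | succ s _ ih => exact fun hf => ih (himg s ▸ hf.image _)
  have hfin : ∀ n, (Set.range (nbType nb col n)).Finite := by
    intro n
    obtain ⟨s, hs, hf, -⟩ := hup n
    exact hfin' s n hs hf
  have hle : ∀ n, (Set.range (nbType nb col n)).ncard ≤
      (Set.range (nbType nb col (n + 1))).ncard := by
    intro n
    rw [himg n]
    exact Set.ncard_image_le (hfin _)
  have hmono : Monotone fun n => (Set.range (nbType nb col n)).ncard := monotone_nat_of_le_succ hle
  have hstab : ∀ n, (Set.range (nbType nb col n)).ncard =
      (Set.range (nbType nb col (n + 1))).ncard → ∀ x y, nbType nb col n x = nbType nb col n y →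
      nbType nb col (n + 1) x = nbType nb col (n + 1) y := by
    intro n hn x y hxy
    have hinj : Set.InjOn (NbType.trunc n) (Set.range (nbType nb col (n + 1))) := by
      apply Set.injOn_of_ncard_image_eq _ (hfin _)
      rw [← himg, hn]
    apply hinj ⟨x, rfl⟩ ⟨y, rfl⟩
    rw [trunc_nbType, trunc_nbType, hxy]
  have hker : ∀ n, (∀ x y, nbType nb col n x = nbType nb col n y →
      nbType nb col (n + 1) x = nbType nb col (n + 1) y) →
      (Set.range (nbType nb col n)).ncard = (Set.range (nbType nb col (n + 1))).ncard := by
    intro n h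
    rw [himg n]
    apply Set.InjOn.ncard_image
    rintro _ ⟨x, rfl⟩ _ ⟨y, rfl⟩ hxy
    rw [trunc_nbType, trunc_nbType] at hxy
    exact h x y hxy
  have hnext : ∀ n, (∀ x y, nbType nb col n x = nbType nb col n y →
      nbType nb col (n + 1) x = nbType nb col (n + 1) y) →
      (∀ x y, nbType nb col (n + 1) x = nbType nb col (n + 1) y →
      nbType nb col (n + 1 + 1) x = nbType nb col (n + 1 + 1) y) := by
    intro n h x y hxy
    rw [nbType_succ_eq] at hxy ⊢
    refine ⟨hxy.1, ?_⟩
    have := hxy.2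
    rw [← Multiset.rel_eq, Multiset.rel_map] at this ⊢
    exact this.mono fun u _ v _ huv => h u v huv
  have hstrict : ∀ n, (Set.range (nbType nb col n)).ncard <
      (Set.range (nbType nb col (n + 1))).ncard := by
    intro n
    refine lt_of_le_of_ne (hle n) fun he => ?_
    have hk : ∀ k, ∀ x y, nbType nb col (n + k) x = nbType nb col (n + k) y →
        nbType nb col (n + k + 1) x = nbType nb col (n + k + 1) y := by
      intro k
      induction k with
      | zero => exact hstab n he
      | succ k ih => exact hnext _ ih
    have hconst : ∀ k, (Set.range (nbType nb col (n + k))).ncard =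
        (Set.range (nbType nb col n)).ncard := by
      intro k
      induction k with
      | zero => rfl
      | succ k ih => rw [← ih]; exact (hker _ (hk k)).symm
    obtain ⟨s, hs⟩ := hlow ((Set.range (nbType nb col n)).ncard + 1)
    have h1 := hmono (show s ≤ n + s by omega)
    have h2 := hconst s
    simp only at h1
    omega
  have hgrow : ∀ n k, (Set.range (nbType nb col n)).ncard + k ≤
      (Set.range (nbType nb col (n + k))).ncard := by
    intro n k
    induction k with
    | zero => rfl
    | succ k ih =>
      have := hstrict (n + k)
      have e : n + (k + 1) = n + k + 1 := rfl
      rw [e]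
      omega
  have h0 : 1 ≤ (Set.range (nbType nb col 0)).ncard := by
    change 0 < _
    rw [Set.ncard_pos (hfin 0)]
    by_contra hne
    rw [Set.not_nonempty_iff_eq_empty, Set.range_eq_empty_iff] at hne
    obtain ⟨s, hs⟩ := hlow 1
    rw [Set.range_eq_empty, Set.ncard_empty] at hs
    omega
  have h1 := hgrow 0 n
  rw [Nat.zero_add] at h1
  obtain ⟨s, hs, -, hs'⟩ := hup n
  obtain ⟨k, rfl⟩ := Nat.exists_eq_add_of_le hs
  have h2 := hgrow n k
  omega

end Types

end Sturm

namespace Sturm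

/-! ## Balls in regular trees and types -/

theorem bijOn_update {X Z : Type} {σ : X → Z} {S : Set X} {T : Set Z} (h : Set.BijOn σ S T) {a : X}
    {b : Z} (ha : a ∉ S) (hb : b ∉ T) :
    Set.BijOn (Function.update σ a b) (insert a S) (insert b T) := by
  have he : Set.EqOn σ (Function.update σ a b) S := fun x hx => by
    rw [Function.update_of_ne (ne_of_mem_of_not_mem hx ha)]
  have h1 := h.congr he
  have h2 := h1.insert (a := a) (by simpa using hb)
  simpa using h2

theorem exists_bijOn_of_map_eq {X γ : Type} {τ τ' : X → γ} (s : Multiset X) :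
    ∀ t : Multiset X, s.Nodup → t.Nodup → s.map τ = t.map τ' →
    ∃ σ : X → X, Set.BijOn σ {x | x ∈ s} {z | z ∈ t} ∧ ∀ x ∈ s, τ' (σ x) = τ x := by
  induction s using Multiset.induction with
  | empty =>
    intro t _ _ h
    have ht : t = 0 := by simpa using h.symm
    subst ht
    exact ⟨id, by simp, by simp⟩
  | cons a s ih =>
    intro t hs ht h
    rw [Multiset.nodup_cons] at hs
    have hm : τ a ∈ t.map τ' := by rw [← h]; simp
    obtain ⟨b, hb, hab⟩ := Multiset.mem_map.1 hm
    obtain ⟨t', rfl⟩ := Multiset.exists_cons_of_mem hb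
    rw [Multiset.nodup_cons] at ht
    rw [Multiset.map_cons, Multiset.map_cons, hab, Multiset.cons_inj_right] at h
    obtain ⟨σ, hσ, hτ⟩ := ih t' hs.2 ht.2 h
    refine ⟨Function.update σ a b, ?_, ?_⟩
    · have := bijOn_update hσ (a := a) (b := b) hs.1 ht.1
      convert this using 1 <;> ext <;> simp
    · intro x hx
      by_cases hxa : x = a
      · subst hxa; simpa using hab
      · rw [Function.update_of_ne hxa]
        exact hτ x ((Multiset.mem_cons.1 hx).resolve_left hxa)


theorem exists_bijOn_of_map_eq_of_mem {X γ : Type} {τ τ' : X → γ} {s t : Multiset X} (hs : s.Nodup)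
    (ht : t.Nodup) (h : s.map τ = t.map τ') {p q : X} (hp : p ∈ s) (hq : q ∈ t) (hpq : τ p = τ' q) :
    ∃ σ : X → X, Set.BijOn σ {x | x ∈ s} {z | z ∈ t} ∧ (∀ x ∈ s, τ' (σ x) = τ x) ∧ σ p = q := by
  obtain ⟨s', rfl⟩ := Multiset.exists_cons_of_mem hp
  obtain ⟨t', rfl⟩ := Multiset.exists_cons_of_mem hq
  rw [Multiset.nodup_cons] at hs ht
  rw [Multiset.map_cons, Multiset.map_cons, hpq, Multiset.cons_inj_right] at h
  obtain ⟨σ, hσ, hτ⟩ := exists_bijOn_of_map_eq s' t' hs.2 ht.2 h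
  refine ⟨Function.update σ p q, ?_, ?_, by simp⟩
  · have := bijOn_update hσ (a := p) (b := q) hs.1 ht.1
    convert this using 1 <;> ext <;> simp
  · intro x hx
    by_cases hxa : x = p
    · subst hxa; simpa using hpq.symm
    · rw [Function.update_of_ne hxa]
      exact hτ x ((Multiset.mem_cons.1 hx).resolve_left hxa)

/-- The multiset of neighbors of a vertex (empty when there are infinitely many). -/
def graphNb {W : Type} (H : SimpleGraph W) (x : W) : Multiset W :=
  if h : (H.neighborSet x).Finite then h.toFinset.val else 0

section Tree

variable {W α : Type} {H : SimpleGraph W} {d : ℕ}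

theorem IsRegularTree.finite_neighborSet (hH : IsRegularTree H d) (hd : 0 < d) (x : W) :
    (H.neighborSet x).Finite :=
  Set.finite_of_ncard_pos (by rw [hH.regular x]; exact hd)

theorem IsRegularTree.mem_graphNb (hH : IsRegularTree H d) (hd : 0 < d) {x z : W} :
    z ∈ graphNb H x ↔ H.Adj x z := by
  simp [graphNb, hH.finite_neighborSet hd x]

theorem IsRegularTree.nodup_graphNb (hH : IsRegularTree H d) (hd : 0 < d) (x : W) :
    (graphNb H x).Nodup := by
  simp only [graphNb, hH.finite_neighborSet hd x, dif_pos]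
  exact Finset.nodup _

theorem IsRegularTree.card_graphNb (hH : IsRegularTree H d) (hd : 0 < d) (x : W) :
    (graphNb H x).card = d := by
  have h := hH.finite_neighborSet hd x
  simp only [graphNb, h, dif_pos]
  rw [← hH.regular x, Set.ncard_eq_toFinset_card _ h]
  rfl

theorem eq_of_adj_of_dist_lt (hT : H.IsTree) {x u p q : W} (hp : H.Adj u p) (hq : H.Adj u q)
    (hpu : H.dist x p < H.dist x u) (hqu : H.dist x q < H.dist x u) : p = q := by
  obtain ⟨P, hP, hPl⟩ := hT.connected.exists_path_of_dist x p
  obtain ⟨Q, hQ, hQl⟩ := hT.connected.exists_path_of_dist x q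
  have h1 := hT.dist_eq_dist_add_one_of_adj x hp
  have h2 := hT.dist_eq_dist_add_one_of_adj x hq
  have hP' : (P.concat hp.symm).IsPath :=
    (P.concat hp.symm).isPath_of_length_eq_dist (by rw [SimpleGraph.Walk.length_concat]; omega)
  have hQ' : (Q.concat hq.symm).IsPath :=
    (Q.concat hq.symm).isPath_of_length_eq_dist (by rw [SimpleGraph.Walk.length_concat]; omega)
  have he := (hT.existsUnique_path x u).unique hP' hQ'
  have := congrArg SimpleGraph.Walk.penultimate he
  simpa using this

theorem exists_adj_dist_lt (hT : H.IsTree) {x u : W} {n : ℕ} (h : H.dist x u = n + 1) :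
    ∃ p, H.Adj u p ∧ H.dist x p = n := by
  obtain ⟨P, hP⟩ := hT.connected.exists_walk_length_eq_dist u x
  rw [SimpleGraph.dist_comm, h] at hP
  cases P with
  | nil => simp at hP
  | @cons _ p _ hup P =>
    refine ⟨p, hup, ?_⟩
    have h1 := SimpleGraph.dist_le P
    rw [SimpleGraph.dist_comm] at h1
    have h2 := hT.dist_eq_dist_add_one_of_adj x hup
    rw [SimpleGraph.Walk.length_cons] at hP
    omega

/-- `F` maps the `n`-ball at `x` to the `n`-ball at `y`, with inverse `G`. -/
structure IsBallMap (H : SimpleGraph W) (n : ℕ) (x y : W) (F G : W → W) : Prop where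
  map_center : F x = y
  left_inv : ∀ u, H.dist x u ≤ n → G (F u) = u
  adj : ∀ u v, H.dist x u ≤ n → H.dist x v ≤ n → H.Adj u v → H.Adj (F u) (F v)

theorem BallEquiv.exists_isBallMap {φ : W → α} {n : ℕ} {x y : W} (h : BallEquiv H φ n x y) :
    ∃ F G, IsBallMap H n x y F G ∧ IsBallMap H n y x G F ∧
      ∀ u, H.dist x u ≤ n → φ (F u) = φ u := by
  obtain ⟨f, hadj, hcol, hc⟩ := h
  let F : W → W := fun u => if h : H.dist x u ≤ n then (f ⟨u, h⟩).1 else u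
  let G : W → W := fun u => if h : H.dist y u ≤ n then (f.symm ⟨u, h⟩).1 else u
  have hF : ∀ u (h : H.dist x u ≤ n), F u = (f ⟨u, h⟩).1 := fun u h => dif_pos h
  have hG : ∀ u (h : H.dist y u ≤ n), G u = (f.symm ⟨u, h⟩).1 := fun u h => dif_pos h
  have hx : H.dist x x ≤ n := by simp
  have hy : H.dist y y ≤ n := by simp
  refine ⟨F, G, ⟨?_, ?_, ?_⟩, ⟨?_, ?_, ?_⟩, ?_⟩
  · rw [hF x hx]; exact hc
  · intro u hu
    rw [hG _ (by rw [hF u hu]; exact (f ⟨u, hu⟩).2)]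
    simp only [hF u hu, Subtype.coe_eta, Equiv.symm_apply_apply]
  · intro u v hu hv h
    rw [hF u hu, hF v hv]
    exact (hadj ⟨u, hu⟩ ⟨v, hv⟩).1 h
  · rw [hG y hy]
    have : f ⟨x, hx⟩ = ⟨y, hy⟩ := Subtype.ext hc
    rw [← this, Equiv.symm_apply_apply]
  · intro u hu
    rw [hF _ (by rw [hG u hu]; exact (f.symm ⟨u, hu⟩).2)]
    simp only [hG u hu, Subtype.coe_eta, Equiv.apply_symm_apply]
  · intro u v hu hv h
    rw [hG u hu, hG v hv]
    apply (hadj _ _).2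
    simpa using h
  · intro u hu; rw [hF u hu]; exact hcol ⟨u, hu⟩

theorem IsBallMap.restrict (hT : H.IsTree) {n : ℕ} {x y z : W} {F G : W → W}
    (h : IsBallMap H (n + 1) x y F G) (hz : H.Adj x z) : IsBallMap H n z (F z) F G := by
  have hdz : H.dist x z = 1 := SimpleGraph.dist_eq_one_iff_adj.2 hz
  have hsub : ∀ u, H.dist z u ≤ n → H.dist x u ≤ n + 1 := fun u hu => by
    have := hT.connected.dist_triangle (u := x) (v := z) (w := u)
    omega
  exact ⟨rfl, fun u hu => h.left_inv u (hsub u hu),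
    fun u v hu hv => h.adj u v (hsub u hu) (hsub v hv)⟩

theorem nbType_eq_of_isBallMap (hH : IsRegularTree H d) (hd : 0 < d) {φ : W → α} {n : ℕ} {x y : W}
    {F G : W → W} (hF : IsBallMap H n x y F G) (hG : IsBallMap H n y x G F)
    (hφ : ∀ u, H.dist x u ≤ n → φ (F u) = φ u) :
    nbType (graphNb H) φ (n + 1) x = nbType (graphNb H) φ (n + 1) y := by
  induction n generalizing x y with
  | zero =>
    rw [nbType_succ_eq]
    refine ⟨by rw [← hφ x (by simp), hF.map_center], ?_⟩
    have hc : ∀ z, (graphNb H z).map (nbType (graphNb H) φ 0) = Multiset.replicate d () := by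
      intro z
      rw [← hH.card_graphNb hd z]
      exact Multiset.map_const' _ _
    rw [hc, hc]
  | succ n ih =>
    rw [nbType_succ_eq]
    refine ⟨by rw [← hφ x (by simp), hF.map_center], ?_⟩
    have d1 : ∀ {u v}, H.Adj u v → H.dist u v ≤ n + 1 := fun h => by
      rw [SimpleGraph.dist_eq_one_iff_adj.2 h]; omega
    have hadjF : ∀ z, H.Adj x z → H.Adj y (F z) := fun z hz => by
      have := hF.adj x z (by simp) (d1 hz) hz
      rwa [hF.map_center] at this
    have hadjG : ∀ z, H.Adj y z → H.Adj x (G z) := fun z hz => by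
      have := hG.adj y z (by simp) (d1 hz) hz
      rwa [hG.map_center] at this
    refine Multiset.map_eq_map_of_bij_of_nodup _ _ (hH.nodup_graphNb hd x) (hH.nodup_graphNb hd y)
      (fun z _ => F z) ?_ ?_ ?_ ?_
    · intro z hz
      rw [hH.mem_graphNb hd] at hz ⊢
      exact hadjF z hz
    · intro z hz z' hz' he
      rw [hH.mem_graphNb hd] at hz hz'
      rw [← hF.left_inv z (d1 hz), ← hF.left_inv z' (d1 hz')]
      exact congrArg G he
    · intro z hz
      rw [hH.mem_graphNb hd] at hz
      exact ⟨G z, (hH.mem_graphNb hd).2 (hadjG z hz), hG.left_inv z (d1 hz)⟩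
    · intro z hz
      rw [hH.mem_graphNb hd] at hz
      refine ih (hF.restrict hH.isTree hz) ?_ ?_
      · have := hG.restrict hH.isTree (hadjF z hz)
        rwa [hF.left_inv z (d1 hz)] at this
      · intro u hu
        apply hφ
        have := hH.isTree.connected.dist_triangle (u := x) (v := z) (w := u)
        have := SimpleGraph.dist_eq_one_iff_adj.2 hz
        omega

end Tree

end Sturm

namespace Sturm

section Tree

variable {W α : Type} {H : SimpleGraph W} {d : ℕ}

/-- `F` maps `x` to `y`, is locally bijective in the interior of the `r`-ball at `x`, and
preserves types of depth decreasing from `n + 1` at `x` to `n + 1 - r` on the boundary. -/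
structure IsTypeMap (H : SimpleGraph W) (φ : W → α) (n r : ℕ) (x y : W) (F : W → W) : Prop where
  map_center : F x = y
  bijOn : ∀ u, H.dist x u < r → Set.BijOn F {z | H.Adj u z} {z | H.Adj (F u) z}
  type_eq : ∀ u, H.dist x u ≤ r → nbType (graphNb H) φ (n + 1 - H.dist x u) u =
    nbType (graphNb H) φ (n + 1 - H.dist x u) (F u)

theorem IsTypeMap.exists_succ (hH : IsRegularTree H d) (hd : 0 < d) {φ : W → α} {n r : ℕ} {x y : W}
    {F : W → W} (h : IsTypeMap H φ n r x y F) (hr : r + 1 ≤ n) :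
    ∃ F', IsTypeMap H φ n (r + 1) x y F' := by
  have hT := hH.isTree
  have hex : ∀ u, ∃ σ : W → W, H.dist x u = r →
      Set.BijOn σ {z | H.Adj u z} {z | H.Adj (F u) z} ∧
      (∀ z, H.Adj u z → nbType (graphNb H) φ (n - r) (σ z) = nbType (graphNb H) φ (n - r) z) ∧
      ∀ z, H.Adj u z → H.dist x z < H.dist x u → σ z = F z := by
    intro u
    by_cases hu : H.dist x u = r
    swap
    · exact ⟨id, fun h => absurd h hu⟩
    have ht := h.type_eq u hu.le
    rw [hu, show n + 1 - r = (n - r) + 1 by omega, nbType_succ_eq] at ht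
    have hs : {z | H.Adj u z} = {z | z ∈ graphNb H u} := by
      ext z; exact (hH.mem_graphNb hd).symm
    have hs' : {z | H.Adj (F u) z} = {z | z ∈ graphNb H (F u)} := by
      ext z; exact (hH.mem_graphNb hd).symm
    rw [hs, hs']
    cases r with
    | zero =>
      obtain ⟨σ, hσ, hσt⟩ := exists_bijOn_of_map_eq _ _ (hH.nodup_graphNb hd u)
        (hH.nodup_graphNb hd (F u)) ht.2
      exact ⟨σ, fun _ => ⟨hσ, fun z hz => hσt z ((hH.mem_graphNb hd).2 hz), fun z _ hz => by omega⟩⟩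
    | succ r =>
      obtain ⟨p, hp, hpd⟩ := exists_adj_dist_lt hT hu
      have hFp : H.Adj (F u) (F p) := ((h.bijOn p (by omega)).mapsTo hp.symm).symm
      have htp := h.type_eq p (by omega)
      obtain ⟨σ, hσ, hσt, hσp⟩ := exists_bijOn_of_map_eq_of_mem (hH.nodup_graphNb hd u)
        (hH.nodup_graphNb hd (F u)) ht.2 ((hH.mem_graphNb hd).2 hp) ((hH.mem_graphNb hd).2 hFp)
        (nbType_eq_of_le (by omega) htp)
      refine ⟨σ, fun _ => ⟨hσ, fun z hz => hσt z ((hH.mem_graphNb hd).2 hz), fun z hz hzu => ?_⟩⟩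
      rw [eq_of_adj_of_dist_lt hT hz hp hzu (by omega)]
      exact hσp
  choose σ hσ using hex
  have hpar : ∀ w, ∃ p, H.dist x w = r + 1 → H.Adj w p ∧ H.dist x p = r := by
    intro w
    by_cases hw : H.dist x w = r + 1
    · obtain ⟨p, hp⟩ := exists_adj_dist_lt hT hw
      exact ⟨p, fun _ => hp⟩
    · exact ⟨w, fun h => absurd h hw⟩
  choose par hpar using hpar
  let F' : W → W := fun w => if H.dist x w ≤ r then F w else σ (par w) w
  have hF' : ∀ w, H.dist x w ≤ r → F' w = F w := fun w hw => if_pos hw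
  have hσF' : ∀ u z, H.dist x u = r → H.Adj u z → F' z = σ u z := by
    intro u z hu hz
    rcases hT.dist_eq_dist_add_one_of_adj x hz with h1 | h1
    · rw [hF' z (by omega), (hσ u hu).2.2 z hz (by omega)]
    · have hz' : H.dist x z = r + 1 := by omega
      have hp := hpar z hz'
      have he : par z = u := eq_of_adj_of_dist_lt hT (x := x) hp.1 hz.symm (by omega) (by omega)
      change (if H.dist x z ≤ r then F z else σ (par z) z) = _
      rw [if_neg (by omega), he]
  refine ⟨F', ?_, ?_, ?_⟩
  · rw [hF' x (by simp), h.map_center]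
  · intro u hu
    rw [hF' u (by omega)]
    rcases Nat.lt_succ_iff_lt_or_eq.1 hu with hu | hu
    · refine (h.bijOn u hu).congr fun z hz => (hF' z ?_).symm
      have := hT.dist_eq_dist_add_one_of_adj x hz
      omega
    · exact (hσ u hu).1.congr fun z hz => (hσF' u z hu hz).symm
  · intro u hu
    by_cases hu' : H.dist x u ≤ r
    · rw [hF' u hu']
      exact h.type_eq u hu'
    · have hu2 : H.dist x u = r + 1 := by omega
      have hp := hpar u hu2
      rw [hσF' (par u) u hp.2 hp.1.symm, hu2, show n + 1 - (r + 1) = n - r by omega]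
      exact ((hσ (par u) hp.2).2.1 u hp.1.symm).symm

theorem exists_isTypeMap (hH : IsRegularTree H d) (hd : 0 < d) {φ : W → α} {n : ℕ} {x y : W}
    (h : nbType (graphNb H) φ (n + 1) x = nbType (graphNb H) φ (n + 1) y) (r : ℕ) (hr : r ≤ n) :
    ∃ F, IsTypeMap H φ n r x y F := by
  induction r with
  | zero =>
    refine ⟨fun _ => y, rfl, fun u hu => by omega, fun u hu => ?_⟩
    obtain rfl : x = u := (hH.isTree.connected.dist_eq_zero_iff).1 (by omega)
    rw [SimpleGraph.dist_self, Nat.sub_zero]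
    exact h
  | succ r ih =>
    obtain ⟨F, hF⟩ := ih (by omega)
    exact hF.exists_succ hH hd hr

theorem IsTypeMap.dist_eq (hT : H.IsTree) {φ : W → α} {n r : ℕ} {x y : W} {F : W → W}
    (h : IsTypeMap H φ n r x y F) (m : ℕ) :
    ∀ u, H.dist x u = m → m ≤ r → H.dist y (F u) = m := by
  induction m using Nat.strong_induction_on with
  | _ m ih =>
    intro u hu hm
    match m with
    | 0 =>
      obtain rfl : x = u := hT.connected.dist_eq_zero_iff.1 hu
      rw [h.map_center, SimpleGraph.dist_self]
    | 1 =>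
      have hxu : H.Adj x u := SimpleGraph.dist_eq_one_iff_adj.1 hu
      have := (h.bijOn x (by rw [SimpleGraph.dist_self]; omega)).mapsTo hxu
      rw [h.map_center] at this
      exact SimpleGraph.dist_eq_one_iff_adj.2 this
    | m + 2 =>
      obtain ⟨p, hp, hpd⟩ := exists_adj_dist_lt hT hu
      obtain ⟨g, hg, hgd⟩ := exists_adj_dist_lt hT hpd
      have hb := h.bijOn p (by omega)
      have h1 := ih (m + 1) (by omega) p hpd (by omega)
      have h2 := ih m (by omega) g hgd (by omega)
      have h3 : H.Adj (F p) (F u) := hb.mapsTo hp.symm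
      have h4 : H.Adj (F p) (F g) := hb.mapsTo hg
      rcases hT.dist_eq_dist_add_one_of_adj y h3 with h5 | h5
      · exfalso
        have he := eq_of_adj_of_dist_lt hT (x := y) h3 h4 (by omega) (by omega)
        have := hb.injOn hp.symm hg he
        subst this
        omega
      · omega

theorem IsTypeMap.injective (hT : H.IsTree) {φ : W → α} {n r : ℕ} {x y : W} {F : W → W}
    (h : IsTypeMap H φ n r x y F) (m : ℕ) :
    ∀ u v, H.dist x u = m → m ≤ r → H.dist x v ≤ r → F u = F v → u = v := by
  induction m with
  | zero =>
    intro u v hu _ hv he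
    have h1 := h.dist_eq hT 0 u hu (by omega)
    have h2 := h.dist_eq hT _ v rfl hv
    rw [← he, h1] at h2
    rw [← hT.connected.dist_eq_zero_iff.1 hu, ← hT.connected.dist_eq_zero_iff.1 h2.symm]
  | succ m ih =>
    intro u v hu hm hv he
    have h1 := h.dist_eq hT _ u hu hm
    have h2 := h.dist_eq hT _ v rfl hv
    rw [← he, h1] at h2
    obtain ⟨p, hp, hpd⟩ := exists_adj_dist_lt hT hu
    obtain ⟨q, hq, hqd⟩ := exists_adj_dist_lt hT h2.symm
    have h3 := h.dist_eq hT _ p hpd (by omega)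
    have h4 := h.dist_eq hT _ q hqd (by omega)
    have hp' : H.Adj (F u) (F p) := ((h.bijOn p (by omega)).mapsTo hp.symm).symm
    have hq' : H.Adj (F u) (F q) := by
      rw [he]
      exact ((h.bijOn q (by omega)).mapsTo hq.symm).symm
    have hpq := ih p q hpd (by omega) (by omega)
      (eq_of_adj_of_dist_lt hT (x := y) hp' hq' (by omega) (by omega))
    subst hpq
    exact (h.bijOn p (by omega)).injOn hp.symm hq.symm he

theorem IsTypeMap.surjective (hT : H.IsTree) {φ : W → α} {n r : ℕ} {x y : W} {F : W → W}
    (h : IsTypeMap H φ n r x y F) (m : ℕ) :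
    ∀ w, H.dist y w = m → m ≤ r → ∃ u, H.dist x u ≤ m ∧ F u = w := by
  induction m with
  | zero =>
    intro w hw _
    refine ⟨x, by simp, ?_⟩
    rw [h.map_center]
    exact hT.connected.dist_eq_zero_iff.1 hw
  | succ m ih =>
    intro w hw hm
    obtain ⟨q, hq, hqd⟩ := exists_adj_dist_lt hT hw
    obtain ⟨p, hp, rfl⟩ := ih q hqd (by omega)
    obtain ⟨u, hu, rfl⟩ := (h.bijOn p (by omega)).surjOn hq.symm
    have := hT.dist_eq_dist_add_one_of_adj x hu
    exact ⟨u, by omega, rfl⟩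

theorem IsTypeMap.adj_iff (hT : H.IsTree) {φ : W → α} {n r : ℕ} {x y : W} {F : W → W}
    (h : IsTypeMap H φ n r x y F) {u v : W} (hu : H.dist x u ≤ r) (hv : H.dist x v ≤ r) :
    H.Adj u v ↔ H.Adj (F u) (F v) := by
  have hmp : ∀ u v, H.dist x u < r → H.dist x v ≤ r → (H.Adj u v ↔ H.Adj (F u) (F v)) := by
    intro u v hu hv
    refine ⟨fun huv => (h.bijOn u hu).mapsTo huv, fun huv => ?_⟩
    obtain ⟨w, hw, hwv⟩ := (h.bijOn u hu).surjOn huv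
    have h1 := hT.dist_eq_dist_add_one_of_adj x hw
    rwa [h.injective hT _ v w rfl hv (by omega) hwv.symm]
  have h1 := h.dist_eq hT _ u rfl hu
  have h2 := h.dist_eq hT _ v rfl hv
  by_cases hu' : H.dist x u < r
  · exact hmp u v hu' hv
  by_cases hv' : H.dist x v < r
  · rw [H.adj_comm u, H.adj_comm (F u)]
    exact hmp v u hv' hu
  constructor
  · intro huv
    have := hT.dist_ne_of_adj x huv
    omega
  · intro huv
    have := hT.dist_ne_of_adj y huv
    omega

theorem IsTypeMap.ballEquiv (hT : H.IsTree) {φ : W → α} {n : ℕ} {x y : W} {F : W → W}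
    (h : IsTypeMap H φ n n x y F) : BallEquiv H φ n x y := by
  let f : {z : W // H.dist x z ≤ n} → {z : W // H.dist y z ≤ n} :=
    fun z => ⟨F z.1, (h.dist_eq hT _ z.1 rfl z.2).le.trans z.2⟩
  have hf : Function.Bijective f := by
    constructor
    · rintro ⟨u, hu⟩ ⟨v, hv⟩ he
      exact Subtype.ext (h.injective hT _ u v rfl hu hv (congrArg Subtype.val he))
    · rintro ⟨w, hw⟩
      obtain ⟨u, hu, he⟩ := h.surjective hT _ w rfl hw
      exact ⟨⟨u, hu.trans hw⟩, Subtype.ext he⟩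
  refine ⟨Equiv.ofBijective f hf, fun u v => h.adj_iff hT u.2 v.2, fun u => ?_, h.map_center⟩
  have ht := h.type_eq u.1 u.2
  have hu := u.2
  rw [show n + 1 - H.dist x u.1 = (n - H.dist x u.1) + 1 by omega, nbType_succ_eq] at ht
  exact ht.1.symm

/-- In a regular tree, two `n`-balls are equivalent if and only if their centers have the same
type of depth `n + 1`. -/
theorem ballEquiv_iff_nbType_eq (hH : IsRegularTree H d) (hd : 0 < d) {φ : W → α} {n : ℕ}
    {x y : W} : BallEquiv H φ n x y ↔
      nbType (graphNb H) φ (n + 1) x = nbType (graphNb H) φ (n + 1) y := by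
  constructor
  · intro h
    obtain ⟨F, G, hF, hG, hφ⟩ := h.exists_isBallMap
    exact nbType_eq_of_isBallMap hH hd hF hG hφ
  · intro h
    obtain ⟨F, hF⟩ := exists_isTypeMap hH hd h n le_rfl
    exact hF.ballEquiv hH.isTree

theorem ncard_ballClasses (hH : IsRegularTree H d) (hd : 0 < d) (φ : W → α) (n : ℕ) :
    (ballClasses H φ n).ncard = (Set.range (nbType (graphNb H) φ (n + 1))).ncard := by
  have himg : ballClasses H φ n = (fun t => {y | t = nbType (graphNb H) φ (n + 1) y}) ''
      Set.range (nbType (graphNb H) φ (n + 1)) := by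
    ext C
    constructor
    · rintro ⟨x, rfl⟩
      refine ⟨_, ⟨x, rfl⟩, ?_⟩
      ext y
      exact (ballEquiv_iff_nbType_eq hH hd).symm
    · rintro ⟨_, ⟨x, rfl⟩, rfl⟩
      refine ⟨x, ?_⟩
      ext y
      exact (ballEquiv_iff_nbType_eq hH hd).symm
  rw [himg]
  apply Set.InjOn.ncard_image
  rintro _ ⟨x, rfl⟩ _ ⟨y, rfl⟩ he
  have : y ∈ {z | nbType (graphNb H) φ (n + 1) x = nbType (graphNb H) φ (n + 1) z} := by
    rw [show {z | nbType (graphNb H) φ (n + 1) x = nbType (graphNb H) φ (n + 1) z} = _ from he]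
    rfl
  exact this

end Tree

end Sturm

namespace Sturm

/-! ## Pointed multigraphs and their concatenations -/

/-- A colored multigraph, given by multisets of neighbors, with two distinguished end vertices. -/
structure MGraph (α : Type) where
  Vert : Type
  nb : Vert → Multiset Vert
  col : Vert → α
  c : Vert
  o : Vert

variable {α : Type}

/-- The type of depth `n` of a vertex. -/
def MGraph.ty (X : MGraph α) (n : ℕ) (v : X.Vert) : NbType α n := nbType X.nb X.col n v

/-- Exchanging the two end vertices. -/
def MGraph.rev (X : MGraph α) : MGraph α := ⟨X.Vert, X.nb, X.col, X.o, X.c⟩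

theorem MGraph.ty_succ_eq {X Y : MGraph α} {n : ℕ} {x : X.Vert} {y : Y.Vert} :
    X.ty (n + 1) x = Y.ty (n + 1) y ↔
      X.col x = Y.col y ∧ (X.nb x).map (X.ty n) = (Y.nb y).map (Y.ty n) :=
  nbType_succ_eq

theorem MGraph.ty_eq_of_le {X Y : MGraph α} {m n : ℕ} (h : m ≤ n) {x : X.Vert} {y : Y.Vert}
    (e : X.ty n x = Y.ty n y) : X.ty m x = Y.ty m y :=
  nbType_eq_of_le h e

theorem MGraph.ty_inj_mono {X : MGraph α} {m n : ℕ} (h : m ≤ n)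
    (hi : Function.Injective (X.ty m)) : Function.Injective (X.ty n) :=
  nbType_inj_mono h hi

/-- `pos` enumerates the vertices of `X` along a path from `c` to `o` with `N` vertices. -/
structure Chain (X : MGraph α) (N : ℕ) (pos : X.Vert → ℕ) : Prop where
  inj : Function.Injective pos
  lt : ∀ v, pos v < N
  surj : ∀ n < N, ∃ v, pos v = n
  pos_c : pos X.c = 0
  pos_o : pos X.o + 1 = N
  near : ∀ z, ∀ z' ∈ X.nb z, pos z' ≤ pos z + 1 ∧ pos z ≤ pos z' + 1
  adj : ∀ z z', pos z = pos z' + 1 → z ∈ X.nb z' ∧ z' ∈ X.nb z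

theorem Chain.rev {X : MGraph α} {N : ℕ} {pos : X.Vert → ℕ} (h : Chain X N pos) :
    Chain X.rev N (fun v => N - 1 - pos v) where
  inj := fun u v e => h.inj (by have := h.lt u; have := h.lt v; simp only at e; omega)
  lt := fun v => by have := h.lt v; omega
  surj := fun n hn => by
    obtain ⟨v, hv⟩ := h.surj (N - 1 - n) (by omega)
    exact ⟨v, by omega⟩
  pos_c := by have := h.pos_o; change N - 1 - pos X.o = 0; omega
  pos_o := by
    have := h.pos_o; have := h.pos_c; change N - 1 - pos X.c + 1 = N; omega
  near := fun z z' hz => by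
    have := h.near z z' hz; have := h.lt z; have := h.lt z'; omega
  adj := fun z z' e => by
    have := h.lt z; have := h.lt z'
    exact (h.adj z' z (by omega)).symm

theorem Chain.eq_c {X : MGraph α} {pos : X.Vert → ℕ} (h : Chain X 1 pos) (v : X.Vert) :
    v = X.c :=
  h.inj (by have := h.lt v; have := h.pos_c; omega)

theorem Chain.o_ne_c {X : MGraph α} {N : ℕ} {pos : X.Vert → ℕ} (h : Chain X N pos) (hN : 2 ≤ N) :
    X.o ≠ X.c := by
  intro e
  have h1 := h.pos_o
  have h2 := h.pos_c
  rw [e] at h1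
  omega

theorem Chain.ncard {X : MGraph α} {N : ℕ} {pos : X.Vert → ℕ} (h : Chain X N pos) :
    Nat.card X.Vert = N := by
  have e : X.Vert ≃ Fin N := Equiv.ofBijective (fun v => (⟨pos v, h.lt v⟩ : Fin N))
    ⟨fun u v e => h.inj (Fin.mk.inj e), fun n => by
      obtain ⟨v, hv⟩ := h.surj n.1 n.2
      exact ⟨v, Fin.ext hv⟩⟩
  rw [Nat.card_congr e, Nat.card_fin]

theorem Chain.finite {X : MGraph α} {N : ℕ} {pos : X.Vert → ℕ} (h : Chain X N pos) :
    Finite X.Vert :=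
  Finite.of_injective (fun v => (⟨pos v, h.lt v⟩ : Fin N)) fun _ _ e => h.inj (Fin.mk.inj e)

theorem Chain.exists_nb_c {X : MGraph α} {N : ℕ} {pos : X.Vert → ℕ} (h : Chain X N pos)
    (hN : 2 ≤ N) : ∃ x, x ≠ X.c ∧
      X.nb X.c = Multiset.replicate ((X.nb X.c).card - (X.nb X.c).count X.c) x +
        Multiset.replicate ((X.nb X.c).count X.c) X.c := by
  obtain ⟨x, hx⟩ := h.surj 1 (by omega)
  have hc := h.pos_c
  have hxc : x ≠ X.c := by
    rintro rfl
    omega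
  refine ⟨x, hxc, ?_⟩
  have h1 := Multiset.filter_add_not (fun v => v = X.c) (X.nb X.c)
  have h2 : (X.nb X.c).filter (fun v => v = X.c) =
      Multiset.replicate ((X.nb X.c).count X.c) X.c := Multiset.filter_eq' _ _
  have h3 : (X.nb X.c).filter (fun v => ¬ v = X.c) =
      Multiset.replicate ((X.nb X.c).filter (fun v => ¬ v = X.c)).card x := by
    rw [Multiset.eq_replicate_card]
    intro v hv
    rw [Multiset.mem_filter] at hv
    have h4 := h.near _ _ hv.1
    refine h.inj ?_
    have h5 : pos v ≠ 0 := fun e => hv.2 (h.inj (by omega))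
    omega
  have h6 := congrArg Multiset.card h1
  rw [Multiset.card_add, h2, Multiset.card_replicate] at h6
  rw [show (X.nb X.c).card - (X.nb X.c).count X.c =
    ((X.nb X.c).filter (fun v => ¬ v = X.c)).card by omega, ← h3, ← h2, add_comm, h1]

/-- The invariants of a pair of chains which have, at depth `s`, only the type of the common end
vertex in common. -/
structure PairInv (d : ℕ) (X Y : MGraph α) (N M s : ℕ) : Prop where
  level : s + 2 = N + M
  chX : ∃ pos, Chain X N pos
  chY : ∃ pos, Chain Y M pos
  cardX : ∀ v, (X.nb v).card = d
  cardY : ∀ v, (Y.nb v).card = d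
  injX : Function.Injective (X.ty s)
  injY : Function.Injective (Y.ty s)
  sep : ∀ u v, X.ty s u = Y.ty s v ↔ u = X.c ∧ v = Y.c
  ne : X.ty (s + 1) X.c ≠ Y.ty (s + 1) Y.c

theorem PairInv.symm {d : ℕ} {X Y : MGraph α} {N M s : ℕ} (h : PairInv d X Y N M s) :
    PairInv d Y X M N s where
  level := by rw [h.level, add_comm]
  chX := h.chY
  chY := h.chX
  cardX := h.cardY
  cardY := h.cardX
  injX := h.injY
  injY := h.injX
  sep := fun u v => by rw [eq_comm, h.sep, and_comm]
  ne := h.ne.symm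

/-- The `(i,j)`-concatenation, in terms of multisets of neighbors. -/
structure IsIJ (Z X Y : MGraph α) (f : X.Vert → Z.Vert) (g : Y.Vert → Z.Vert) (i j : ℕ) :
    Prop where
  f_inj : Function.Injective f
  g_inj : Function.Injective g
  disj : ∀ u v, f u ≠ g v
  surj : ∀ z, (∃ u, f u = z) ∨ ∃ v, g v = z
  col_f : ∀ u, Z.col (f u) = X.col u
  col_g : ∀ v, Z.col (g v) = Y.col v
  nb_f : ∀ u, u ≠ X.c → Z.nb (f u) = (X.nb u).map f
  nb_g : ∀ v, v ≠ Y.c → Z.nb (g v) = (Y.nb v).map g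
  nb_fc : Z.nb (f X.c) + Multiset.replicate i (f X.c) =
    (X.nb X.c).map f + Multiset.replicate i (g Y.c)
  nb_gc : Z.nb (g Y.c) + Multiset.replicate j (g Y.c) =
    (Y.nb Y.c).map g + Multiset.replicate j (f X.c)
  i_pos : i ≠ 0
  j_pos : j ≠ 0
  c_eq : Z.c = g Y.o
  o_eq : Z.o = f X.o

/-- The `(i)`-concatenation, in terms of multisets of neighbors. -/
structure IsI (Z X Y : MGraph α) (f : X.Vert → Z.Vert) (g : Y.Vert → Z.Vert) : Prop where
  f_inj : Function.Injective f
  g_inj : Function.Injective g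
  c_glue : f X.c = g Y.c
  disj : ∀ u v, f u = g v → u = X.c ∧ v = Y.c
  surj : ∀ z, (∃ u, f u = z) ∨ ∃ v, g v = z
  col_f : ∀ u, Z.col (f u) = X.col u
  col_g : ∀ v, Z.col (g v) = Y.col v
  nb_f : ∀ u, u ≠ X.c → Z.nb (f u) = (X.nb u).map f
  nb_g : ∀ v, v ≠ Y.c → Z.nb (g v) = (Y.nb v).map g
  nb_c : ∃ x y i i' l, x ≠ X.c ∧ y ≠ Y.c ∧ i ≠ 0 ∧ i' ≠ 0 ∧
    X.nb X.c = Multiset.replicate (i + i') x + Multiset.replicate l X.c ∧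
    Y.nb Y.c = Multiset.replicate (i + i') y + Multiset.replicate l Y.c ∧
    Z.nb (f X.c) = Multiset.replicate i (f x) + Multiset.replicate i' (g y) +
      Multiset.replicate l (f X.c)
  c_eq : Z.c = g Y.o
  o_eq : Z.o = f X.o

/-- Propagation along `B` of a difference of types at `B.c`. -/
theorem Chain.propagate {B Z : MGraph α} {M : ℕ} {pos : B.Vert → ℕ} (h : Chain B M pos)
    (e : B.Vert → Z.Vert) (hnb : ∀ v, v ≠ B.c → Z.nb (e v) = (B.nb v).map e)
    (hcol : ∀ v, v ≠ B.c → Z.col (e v) = B.col v) {s : ℕ} (hZ : Function.Injective (Z.ty s))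
    (hB : Function.Injective (B.ty s)) (heq : ∀ v, Z.ty s (e v) = B.ty s v)
    (hne : Z.ty (s + 1) (e B.c) ≠ B.ty (s + 1) B.c) {t : ℕ} (ht : t + 1 = s + M) :
    Function.Injective (Z.ty t) ∧ Function.Injective (B.ty t) ∧
      (∀ z v, Z.ty t z = B.ty t v ↔ z = e B.o ∧ v = B.o) ∧
      Z.ty (t + 1) (e B.o) ≠ B.ty (t + 1) B.o := by
  have hpos : ∀ v, pos v ≠ 0 → v ≠ B.c := by
    rintro v hv rfl
    exact hv h.pos_c
  have hA : ∀ r v, r ≤ pos v → Z.ty (s + r) (e v) = B.ty (s + r) v := by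
    intro r
    induction r with
    | zero => exact fun v _ => heq v
    | succ r ih =>
      intro v hv
      have hv0 := hpos v (by omega)
      refine MGraph.ty_succ_eq.2 ⟨hcol v hv0, ?_⟩
      rw [hnb v hv0, Multiset.map_map]
      refine Multiset.map_congr rfl fun w hw => ih w ?_
      have := h.near _ _ hw
      omega
  have hD : ∀ r v, pos v = r → ∀ w, Z.ty (s + 1 + r) (e v) ≠ B.ty (s + 1 + r) w := by
    intro r
    induction r with
    | zero =>
      intro v hv w hw
      obtain rfl : v = B.c := h.inj (by rw [hv, h.pos_c])
      obtain rfl : B.c = w := hB (by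
        rw [← heq]
        exact MGraph.ty_eq_of_le (by omega) hw)
      exact hne hw
    | succ r ih =>
      intro v hv w hw
      obtain rfl : v = w := hB (by
        rw [← heq]
        exact MGraph.ty_eq_of_le (by omega) hw)
      obtain ⟨v', hv'⟩ := h.surj r (by have := h.lt v; omega)
      have h1 : (Z.nb (e v)).map (Z.ty (s + 1 + r)) = (B.nb v).map (B.ty (s + 1 + r)) :=
        (MGraph.ty_succ_eq.1 hw).2
      rw [hnb v (hpos v (by omega)), Multiset.map_map] at h1
      have h2 := Multiset.mem_map_of_mem (Z.ty (s + 1 + r) ∘ e) (h.adj v v' (by omega)).2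
      rw [h1, Multiset.mem_map] at h2
      obtain ⟨w', -, hw'⟩ := h2
      exact ih v' hv' w' hw'.symm
  have hM := h.pos_o
  refine ⟨MGraph.ty_inj_mono (by omega) hZ, MGraph.ty_inj_mono (by omega) hB, fun z v => ?_, ?_⟩
  · constructor
    · intro he
      obtain rfl : z = e v := hZ (by
        rw [heq]
        exact MGraph.ty_eq_of_le (by omega) he)
      by_cases hv : v = B.o
      · exact ⟨by rw [hv], hv⟩
      · have h1 : pos v ≠ pos B.o := fun e => hv (h.inj e)
        have h2 := h.lt v
        exact absurd (MGraph.ty_eq_of_le (m := s + 1 + pos v) (by omega) he) (hD _ v rfl v)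
    · rintro ⟨rfl, rfl⟩
      obtain rfl : t = s + pos B.o := by omega
      exact hA _ _ le_rfl
  · obtain rfl : t = s + pos B.o := by omega
    have := hD _ B.o rfl B.o
    rwa [show s + 1 + pos B.o = s + pos B.o + 1 by omega] at this

section Concat

variable {d N M s i j : ℕ} {X Y Z : MGraph α} {f : X.Vert → Z.Vert} {g : Y.Vert → Z.Vert}

theorem PairInv.ty_c (h : PairInv d X Y N M s) {n : ℕ} (hn : n ≤ s) :
    X.ty n X.c = Y.ty n Y.c :=
  MGraph.ty_eq_of_le hn ((h.sep _ _).2 ⟨rfl, rfl⟩)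

theorem replicate_add_cancel {β : Type} {i : ℕ} (hi : i ≠ 0) {a b : β} {R : Multiset β}
    (h : R + Multiset.replicate i a = R + Multiset.replicate i b) : a = b :=
  Multiset.replicate_right_injective hi (add_left_cancel h)

theorem IsIJ.ty_eq (hZ : IsIJ Z X Y f g i j) (h : PairInv d X Y N M s) (n : ℕ) (hn : n ≤ s + 1) :
    (∀ u, Z.ty n (f u) = X.ty n u) ∧ ∀ v, Z.ty n (g v) = Y.ty n v := by
  induction n with
  | zero => exact ⟨fun _ => rfl, fun _ => rfl⟩
  | succ n ih =>
    obtain ⟨hf, hg⟩ := ih (by omega)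
    have hc := h.ty_c (n := n) (by omega)
    have hf' : Z.ty n ∘ f = X.ty n := funext hf
    have hg' : Z.ty n ∘ g = Y.ty n := funext hg
    refine ⟨fun u => MGraph.ty_succ_eq.2 ⟨hZ.col_f u, ?_⟩,
      fun v => MGraph.ty_succ_eq.2 ⟨hZ.col_g v, ?_⟩⟩
    · by_cases hu : u = X.c
      · subst hu
        have h1 := congrArg (Multiset.map (Z.ty n)) hZ.nb_fc
        rw [Multiset.map_add, Multiset.map_add, Multiset.map_replicate, Multiset.map_replicate,
          Multiset.map_map, hf', hf, hg, hc] at h1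
        exact add_right_cancel h1
      · rw [hZ.nb_f u hu, Multiset.map_map, hf']
    · by_cases hv : v = Y.c
      · subst hv
        have h1 := congrArg (Multiset.map (Z.ty n)) hZ.nb_gc
        rw [Multiset.map_add, Multiset.map_add, Multiset.map_replicate, Multiset.map_replicate,
          Multiset.map_map, hg', hf, hg, hc] at h1
        exact add_right_cancel h1
      · rw [hZ.nb_g v hv, Multiset.map_map, hg']

theorem IsI.ty_eq (hZ : IsI Z X Y f g) (h : PairInv d X Y N M s) (n : ℕ) (hn : n ≤ s) :
    (∀ u, Z.ty n (f u) = X.ty n u) ∧ ∀ v, Z.ty n (g v) = Y.ty n v := by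
  induction n with
  | zero => exact ⟨fun _ => rfl, fun _ => rfl⟩
  | succ n ih =>
    obtain ⟨hf, hg⟩ := ih (by omega)
    have hc := h.ty_c (n := n) (by omega)
    have hc' := h.ty_c hn
    have hf' : Z.ty n ∘ f = X.ty n := funext hf
    have hg' : Z.ty n ∘ g = Y.ty n := funext hg
    obtain ⟨x, y, i, i', l, hx, hy, hi, hi', hX, hY, hC⟩ := hZ.nb_c
    have hxy : X.ty n x = Y.ty n y := by
      have h1 := (MGraph.ty_succ_eq.1 hc').2
      rw [hX, hY, Multiset.map_add, Multiset.map_add, Multiset.map_replicate,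
        Multiset.map_replicate, Multiset.map_replicate, Multiset.map_replicate, hc] at h1
      exact Multiset.replicate_right_injective (by omega) (add_right_cancel h1)
    have hcc : (Z.nb (f X.c)).map (Z.ty n) = (X.nb X.c).map (X.ty n) := by
      rw [hC, hX, Multiset.replicate_add]
      simp only [Multiset.map_add, Multiset.map_replicate, hf, hg, hxy]
    refine ⟨fun u => MGraph.ty_succ_eq.2 ⟨hZ.col_f u, ?_⟩,
      fun v => MGraph.ty_succ_eq.2 ⟨hZ.col_g v, ?_⟩⟩
    · by_cases hu : u = X.c
      · rw [hu, hcc]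
      · rw [hZ.nb_f u hu, Multiset.map_map, hf']
    · by_cases hv : v = Y.c
      · rw [hv, ← hZ.c_glue, hcc]
        exact (MGraph.ty_succ_eq.1 hc').2
      · rw [hZ.nb_g v hv, Multiset.map_map, hg']

theorem IsIJ.ty_c_ne (h : PairInv d X Y N M s) (u : X.Vert) (v : Y.Vert) :
    X.ty (s + 1) u ≠ Y.ty (s + 1) v := by
  intro e
  obtain ⟨rfl, rfl⟩ := (h.sep u v).1 (MGraph.ty_eq_of_le (by omega) e)
  exact h.ne e

theorem IsIJ.ty_inj (hZ : IsIJ Z X Y f g i j) (h : PairInv d X Y N M s) :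
    Function.Injective (Z.ty (s + 1)) := by
  obtain ⟨hf, hg⟩ := hZ.ty_eq h (s + 1) le_rfl
  intro z z' e
  rcases hZ.surj z with ⟨u, rfl⟩ | ⟨v, rfl⟩ <;> rcases hZ.surj z' with ⟨u', rfl⟩ | ⟨v', rfl⟩
  · rw [hf, hf] at e
    rw [MGraph.ty_inj_mono (Nat.le_succ s) h.injX e]
  · rw [hf, hg] at e
    exact absurd e (IsIJ.ty_c_ne h _ _)
  · rw [hf, hg] at e
    exact absurd e.symm (IsIJ.ty_c_ne h _ _)
  · rw [hg, hg] at e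
    rw [MGraph.ty_inj_mono (Nat.le_succ s) h.injY e]

theorem IsI.ty_inj (hZ : IsI Z X Y f g) (h : PairInv d X Y N M s) :
    Function.Injective (Z.ty s) := by
  obtain ⟨hf, hg⟩ := hZ.ty_eq h s le_rfl
  intro z z' e
  rcases hZ.surj z with ⟨u, rfl⟩ | ⟨v, rfl⟩ <;> rcases hZ.surj z' with ⟨u', rfl⟩ | ⟨v', rfl⟩
  · rw [hf, hf] at e
    rw [h.injX e]
  · rw [hf, hg] at e
    obtain ⟨rfl, rfl⟩ := (h.sep _ _).1 e
    exact hZ.c_glue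
  · rw [hf, hg] at e
    obtain ⟨rfl, rfl⟩ := (h.sep _ _).1 e.symm
    exact hZ.c_glue.symm
  · rw [hg, hg] at e
    rw [h.injY e]

theorem IsIJ.mem_nb (hZ : IsIJ Z X Y f g i j) :
    (∀ u w, u ≠ w → u ∈ X.nb w → f u ∈ Z.nb (f w)) ∧
      ∀ u w, u ≠ w → u ∈ Y.nb w → g u ∈ Z.nb (g w) := by
  constructor
  · intro u w huw hu
    by_cases hw : w = X.c
    · subst hw
      have h1 : f u ∈ Z.nb (f X.c) + Multiset.replicate i (f X.c) := by
        rw [hZ.nb_fc]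
        exact Multiset.mem_add.2 (Or.inl (Multiset.mem_map_of_mem f hu))
      refine (Multiset.mem_add.1 h1).resolve_right fun h2 => huw (hZ.f_inj ?_)
      exact Multiset.eq_of_mem_replicate h2
    · rw [hZ.nb_f w hw]
      exact Multiset.mem_map_of_mem f hu
  · intro u w huw hu
    by_cases hw : w = Y.c
    · subst hw
      have h1 : g u ∈ Z.nb (g Y.c) + Multiset.replicate j (g Y.c) := by
        rw [hZ.nb_gc]
        exact Multiset.mem_add.2 (Or.inl (Multiset.mem_map_of_mem g hu))
      refine (Multiset.mem_add.1 h1).resolve_right fun h2 => huw (hZ.g_inj ?_)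
      exact Multiset.eq_of_mem_replicate h2
    · rw [hZ.nb_g w hw]
      exact Multiset.mem_map_of_mem g hu

theorem IsI.mem_nb (hZ : IsI Z X Y f g) :
    (∀ u w, u ≠ w → u ∈ X.nb w → f u ∈ Z.nb (f w)) ∧
      ∀ u w, u ≠ w → u ∈ Y.nb w → g u ∈ Z.nb (g w) := by
  obtain ⟨x, y, i, i', l, hx, hy, hi, hi', hX, hY, hC⟩ := hZ.nb_c
  constructor
  · intro u w huw hu
    by_cases hw : w = X.c
    · subst hw
      rw [hX, Multiset.mem_add] at hu
      rcases hu with hu | hu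
      · rw [Multiset.eq_of_mem_replicate hu, hC]
        exact Multiset.mem_add.2 (Or.inl (Multiset.mem_add.2 (Or.inl
          (Multiset.mem_replicate.2 ⟨hi, rfl⟩))))
      · exact absurd (Multiset.eq_of_mem_replicate hu) huw
    · rw [hZ.nb_f w hw]
      exact Multiset.mem_map_of_mem f hu
  · intro u w huw hu
    by_cases hw : w = Y.c
    · subst hw
      rw [hY, Multiset.mem_add] at hu
      rcases hu with hu | hu
      · rw [Multiset.eq_of_mem_replicate hu, ← hZ.c_glue, hC]
        exact Multiset.mem_add.2 (Or.inl (Multiset.mem_add.2 (Or.inr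
          (Multiset.mem_replicate.2 ⟨hi', rfl⟩))))
      · exact absurd (Multiset.eq_of_mem_replicate hu) huw
    · rw [hZ.nb_g w hw]
      exact Multiset.mem_map_of_mem g hu

end Concat

end Sturm

namespace Sturm

variable {α : Type} {d N M s i j : ℕ} {X Y Z : MGraph α} {f : X.Vert → Z.Vert}
  {g : Y.Vert → Z.Vert}

theorem IsIJ.card_nb (hZ : IsIJ Z X Y f g i j) (hX : ∀ v, (X.nb v).card = d)
    (hY : ∀ v, (Y.nb v).card = d) (z : Z.Vert) : (Z.nb z).card = d := by
  rcases hZ.surj z with ⟨u, rfl⟩ | ⟨v, rfl⟩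
  · by_cases hu : u = X.c
    · have := congrArg Multiset.card hZ.nb_fc
      simp only [Multiset.card_add, Multiset.card_map, Multiset.card_replicate, hX] at this
      rw [hu]
      omega
    · rw [hZ.nb_f u hu, Multiset.card_map, hX]
  · by_cases hv : v = Y.c
    · have := congrArg Multiset.card hZ.nb_gc
      simp only [Multiset.card_add, Multiset.card_map, Multiset.card_replicate, hY] at this
      rw [hv]
      omega
    · rw [hZ.nb_g v hv, Multiset.card_map, hY]

theorem IsI.card_nb (hZ : IsI Z X Y f g) (hX : ∀ v, (X.nb v).card = d)
    (hY : ∀ v, (Y.nb v).card = d) (z : Z.Vert) : (Z.nb z).card = d := by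
  have hc : (Z.nb (f X.c)).card = d := by
    obtain ⟨x, y, i, i', l, hx, hy, hi, hi', hX', hY', hC⟩ := hZ.nb_c
    have := hX X.c
    rw [hX'] at this
    rw [hC]
    simp only [Multiset.card_add, Multiset.card_replicate] at this ⊢
    exact this
  rcases hZ.surj z with ⟨u, rfl⟩ | ⟨v, rfl⟩
  · by_cases hu : u = X.c
    · rw [hu, hc]
    · rw [hZ.nb_f u hu, Multiset.card_map, hX]
  · by_cases hv : v = Y.c
    · rw [hv, ← hZ.c_glue, hc]
    · rw [hZ.nb_g v hv, Multiset.card_map, hY]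

theorem IsIJ.chain (hZ : IsIJ Z X Y f g i j) {pX : X.Vert → ℕ} {pY : Y.Vert → ℕ}
    (hX : Chain X N pX) (hY : Chain Y M pY) : ∃ pos, Chain Z (N + M) pos := by
  let pos := Function.extend g (fun v => M - 1 - pY v)
    (Function.extend f (fun u => M + pX u) 0)
  have hg : ∀ v, pos (g v) = M - 1 - pY v := fun v => hZ.g_inj.extend_apply _ _ v
  have hf : ∀ u, pos (f u) = M + pX u := fun u => by
    change Function.extend g _ _ (f u) = _
    rw [Function.extend_apply' _ _ _ (fun ⟨v, hv⟩ => hZ.disj u v hv.symm),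
      hZ.f_inj.extend_apply]
  have hXc := hX.pos_c
  have hYc := hY.pos_c
  refine ⟨pos, ?_, ?_, ?_, ?_, ?_, ?_, ?_⟩
  · intro z z' e
    rcases hZ.surj z with ⟨u, rfl⟩ | ⟨v, rfl⟩ <;> rcases hZ.surj z' with ⟨u', rfl⟩ | ⟨v', rfl⟩
    · rw [hf, hf] at e
      rw [hX.inj (by omega : pX u = pX u')]
    · rw [hf, hg] at e
      have := hY.lt v'
      omega
    · rw [hf, hg] at e
      have := hY.lt v
      omega
    · rw [hg, hg] at e
      have := hY.lt v
      have := hY.lt v'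
      rw [hY.inj (by omega : pY v = pY v')]
  · intro z
    rcases hZ.surj z with ⟨u, rfl⟩ | ⟨v, rfl⟩
    · have := hX.lt u
      rw [hf]
      omega
    · have := hY.lt v
      rw [hg]
      omega
  · intro n hn
    by_cases h : n < M
    · obtain ⟨v, hv⟩ := hY.surj (M - 1 - n) (by omega)
      exact ⟨g v, by rw [hg]; omega⟩
    · obtain ⟨u, hu⟩ := hX.surj (n - M) (by omega)
      exact ⟨f u, by rw [hf]; omega⟩
  · have := hY.pos_o
    rw [hZ.c_eq, hg]
    omega
  · have := hX.pos_o
    rw [hZ.o_eq, hf]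
    omega
  · intro z z' hz
    rcases hZ.surj z with ⟨u, rfl⟩ | ⟨v, rfl⟩
    · by_cases hu : u = X.c
      · subst hu
        have h1 : z' ∈ (X.nb X.c).map f + Multiset.replicate i (g Y.c) := by
          rw [← hZ.nb_fc]
          exact Multiset.mem_add.2 (Or.inl hz)
        rcases Multiset.mem_add.1 h1 with h1 | h1
        · obtain ⟨w, hw, rfl⟩ := Multiset.mem_map.1 h1
          have := hX.near _ _ hw
          rw [hf, hf]
          omega
        · have := hY.lt Y.c
          rw [Multiset.eq_of_mem_replicate h1, hf, hg]
          omega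
      · rw [hZ.nb_f u hu] at hz
        obtain ⟨w, hw, rfl⟩ := Multiset.mem_map.1 hz
        have := hX.near _ _ hw
        rw [hf, hf]
        omega
    · by_cases hv : v = Y.c
      · subst hv
        have h1 : z' ∈ (Y.nb Y.c).map g + Multiset.replicate j (f X.c) := by
          rw [← hZ.nb_gc]
          exact Multiset.mem_add.2 (Or.inl hz)
        rcases Multiset.mem_add.1 h1 with h1 | h1
        · obtain ⟨w, hw, rfl⟩ := Multiset.mem_map.1 h1
          have := hY.near _ _ hw
          have := hY.lt w
          rw [hg, hg]
          omega
        · have := hY.lt Y.c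
          rw [Multiset.eq_of_mem_replicate h1, hf, hg]
          omega
      · rw [hZ.nb_g v hv] at hz
        obtain ⟨w, hw, rfl⟩ := Multiset.mem_map.1 hz
        have := hY.near _ _ hw
        have := hY.lt w
        have := hY.lt v
        rw [hg, hg]
        omega
  · intro z z' e
    rcases hZ.surj z with ⟨u, rfl⟩ | ⟨v, rfl⟩ <;> rcases hZ.surj z' with ⟨u', rfl⟩ | ⟨v', rfl⟩
    · rw [hf, hf] at e
      have hne : u ≠ u' := by
        rintro rfl
        omega
      have h := hX.adj u u' (by omega)
      exact ⟨hZ.mem_nb.1 _ _ hne h.1, hZ.mem_nb.1 _ _ hne.symm h.2⟩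
    · rw [hf, hg] at e
      have := hY.lt v'
      obtain rfl : u = X.c := hX.inj (by omega)
      obtain rfl : v' = Y.c := hY.inj (by omega)
      constructor
      · have h1 : f X.c ∈ Z.nb (g Y.c) + Multiset.replicate j (g Y.c) := by
          rw [hZ.nb_gc]
          exact Multiset.mem_add.2 (Or.inr (Multiset.mem_replicate.2 ⟨hZ.j_pos, rfl⟩))
        exact (Multiset.mem_add.1 h1).resolve_right fun h2 =>
          hZ.disj _ _ (Multiset.eq_of_mem_replicate h2)
      · have h1 : g Y.c ∈ Z.nb (f X.c) + Multiset.replicate i (f X.c) := by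
          rw [hZ.nb_fc]
          exact Multiset.mem_add.2 (Or.inr (Multiset.mem_replicate.2 ⟨hZ.i_pos, rfl⟩))
        exact (Multiset.mem_add.1 h1).resolve_right fun h2 =>
          hZ.disj _ _ (Multiset.eq_of_mem_replicate h2).symm
    · rw [hf, hg] at e
      omega
    · rw [hg, hg] at e
      have := hY.lt v
      have := hY.lt v'
      have hne : v ≠ v' := by
        rintro rfl
        omega
      have h := hY.adj v' v (by omega)
      exact ⟨hZ.mem_nb.2 _ _ hne h.2, hZ.mem_nb.2 _ _ hne.symm h.1⟩

theorem IsI.chain (hZ : IsI Z X Y f g) {pX : X.Vert → ℕ} {pY : Y.Vert → ℕ}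
    (hX : Chain X N pX) (hY : Chain Y M pY) : ∃ pos, Chain Z (N + M - 1) pos := by
  let pos := Function.extend g (fun v => M - 1 - pY v)
    (Function.extend f (fun u => M - 1 + pX u) 0)
  have hXc := hX.pos_c
  have hYc := hY.pos_c
  have hMpos := hY.lt Y.c
  have hg : ∀ v, pos (g v) = M - 1 - pY v := fun v => hZ.g_inj.extend_apply _ _ v
  have hf : ∀ u, pos (f u) = M - 1 + pX u := fun u => by
    by_cases hu : u = X.c
    · rw [hu, hZ.c_glue, hg]
      omega
    change Function.extend g _ _ (f u) = _
    rw [Function.extend_apply' _ _ _ (fun ⟨v, hv⟩ => hu (hZ.disj u v hv.symm).1),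
      hZ.f_inj.extend_apply]
  have hfg : ∀ u v, pX u = 0 → pY v = 0 → f u = g v := by
    intro u v hu hv
    rw [hX.inj (hu.trans hXc.symm), hY.inj (hv.trans hYc.symm), hZ.c_glue]
  have adjf : ∀ u u', pX u = pX u' + 1 → f u ∈ Z.nb (f u') ∧ f u' ∈ Z.nb (f u) := by
    intro u u' e
    have hne : u ≠ u' := by
      rintro rfl
      omega
    have h := hX.adj u u' e
    exact ⟨hZ.mem_nb.1 _ _ hne h.1, hZ.mem_nb.1 _ _ hne.symm h.2⟩
  have adjg : ∀ u u', pY u = pY u' + 1 → g u ∈ Z.nb (g u') ∧ g u' ∈ Z.nb (g u) := by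
    intro u u' e
    have hne : u ≠ u' := by
      rintro rfl
      omega
    have h := hY.adj u u' e
    exact ⟨hZ.mem_nb.2 _ _ hne h.1, hZ.mem_nb.2 _ _ hne.symm h.2⟩
  have nearc : ∀ z' ∈ Z.nb (f X.c), pos z' ≤ M ∧ M - 1 ≤ pos z' + 1 := by
    intro z' hz
    obtain ⟨x, y, i, i', l, hx, hy, hi, hi', hX', hY', hC⟩ := hZ.nb_c
    have h1 := hX.near X.c x (by
      rw [hX']
      exact Multiset.mem_add.2 (Or.inl (Multiset.mem_replicate.2 ⟨by omega, rfl⟩)))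
    have h2 := hY.near Y.c y (by
      rw [hY']
      exact Multiset.mem_add.2 (Or.inl (Multiset.mem_replicate.2 ⟨by omega, rfl⟩)))
    rw [hC, Multiset.mem_add, Multiset.mem_add] at hz
    rcases hz with (hz | hz) | hz <;> rw [Multiset.eq_of_mem_replicate hz]
    · rw [hf]
      omega
    · rw [hg]
      omega
    · rw [hf]
      omega
  refine ⟨pos, ?_, ?_, ?_, ?_, ?_, ?_, ?_⟩
  · intro z z' e
    rcases hZ.surj z with ⟨u, rfl⟩ | ⟨v, rfl⟩ <;> rcases hZ.surj z' with ⟨u', rfl⟩ | ⟨v', rfl⟩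
    · rw [hf, hf] at e
      rw [hX.inj (by omega : pX u = pX u')]
    · rw [hf, hg] at e
      have := hY.lt v'
      exact hfg u v' (by omega) (by omega)
    · rw [hf, hg] at e
      have := hY.lt v
      exact (hfg u' v (by omega) (by omega)).symm
    · rw [hg, hg] at e
      have := hY.lt v
      have := hY.lt v'
      rw [hY.inj (by omega : pY v = pY v')]
  · intro z
    rcases hZ.surj z with ⟨u, rfl⟩ | ⟨v, rfl⟩
    · have := hX.lt u
      rw [hf]
      omega
    · have := hY.lt v
      have := hX.lt X.c
      rw [hg]
      omega
  · intro n hn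
    by_cases h : n < M
    · obtain ⟨v, hv⟩ := hY.surj (M - 1 - n) (by omega)
      exact ⟨g v, by rw [hg]; omega⟩
    · obtain ⟨u, hu⟩ := hX.surj (n - (M - 1)) (by omega)
      exact ⟨f u, by rw [hf]; omega⟩
  · have := hY.pos_o
    rw [hZ.c_eq, hg]
    omega
  · have := hX.pos_o
    rw [hZ.o_eq, hf]
    omega
  · intro z z' hz
    rcases hZ.surj z with ⟨u, rfl⟩ | ⟨v, rfl⟩
    · by_cases hu : u = X.c
      · subst hu
        have := nearc z' hz
        rw [hf]
        omega
      · rw [hZ.nb_f u hu] at hz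
        obtain ⟨w, hw, rfl⟩ := Multiset.mem_map.1 hz
        have := hX.near _ _ hw
        rw [hf, hf]
        omega
    · by_cases hv : v = Y.c
      · subst hv
        rw [← hZ.c_glue] at hz
        have := nearc z' hz
        rw [hg]
        omega
      · rw [hZ.nb_g v hv] at hz
        obtain ⟨w, hw, rfl⟩ := Multiset.mem_map.1 hz
        have := hY.near _ _ hw
        have := hY.lt w
        have := hY.lt v
        rw [hg, hg]
        omega
  · intro z z' e
    rcases hZ.surj z with ⟨u, rfl⟩ | ⟨v, rfl⟩ <;> rcases hZ.surj z' with ⟨u', rfl⟩ | ⟨v', rfl⟩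
    · rw [hf, hf] at e
      exact adjf u u' (by omega)
    · rw [hf, hg] at e
      have := hY.lt v'
      by_cases hv : pY v' = 0
      · rw [← hfg X.c v' hXc hv]
        exact adjf u X.c (by omega)
      · rw [hfg u Y.c (by omega) hYc]
        exact (adjg v' Y.c (by omega)).symm
    · rw [hf, hg] at e
      omega
    · rw [hg, hg] at e
      have := hY.lt v
      have := hY.lt v'
      exact (adjg v' v (by omega)).symm

theorem IsIJ.pairInv (hZ : IsIJ Z X Y f g i j) (h : PairInv d X Y N M s) :
    PairInv d Z Y.rev (N + M) M (s + M) := by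
  obtain ⟨pX, hX⟩ := h.chX
  obtain ⟨pY, hY⟩ := h.chY
  obtain ⟨hf, hg⟩ := hZ.ty_eq h (s + 1) le_rfl
  have hne : Z.ty (s + 1 + 1) (g Y.c) ≠ Y.ty (s + 1 + 1) Y.c := by
    intro e
    have h1 := (MGraph.ty_succ_eq.1 e).2
    have h2 := congrArg (Multiset.map (Z.ty (s + 1))) hZ.nb_gc
    rw [Multiset.map_add, Multiset.map_add, Multiset.map_replicate, Multiset.map_replicate,
      Multiset.map_map, show Z.ty (s + 1) ∘ g = Y.ty (s + 1) from funext hg, h1, hf, hg] at h2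
    exact h.ne (replicate_add_cancel hZ.j_pos h2).symm
  obtain ⟨h1, h2, h3, h4⟩ := hY.propagate g hZ.nb_g (fun v _ => hZ.col_g v) (hZ.ty_inj h)
    (MGraph.ty_inj_mono (Nat.le_succ s) h.injY) hg hne (t := s + M) (by omega)
  refine ⟨by have := h.level; omega, hZ.chain hX hY, ⟨_, hY.rev⟩, hZ.card_nb h.cardX h.cardY,
    h.cardY, h1, h2, ?_, ?_⟩
  · rw [hZ.c_eq]
    exact h3
  · rw [hZ.c_eq]
    exact h4

theorem IsI.pairInv (hZ : IsI Z X Y f g) (h : PairInv d X Y N M s) :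
    PairInv d Z Y.rev (N + M - 1) M (s + M - 1) := by
  obtain ⟨pX, hX⟩ := h.chX
  obtain ⟨pY, hY⟩ := h.chY
  obtain ⟨hf, hg⟩ := hZ.ty_eq h s le_rfl
  have hM := hY.lt Y.c
  have hN := hX.lt X.c
  have hne : Z.ty (s + 1) (g Y.c) ≠ Y.ty (s + 1) Y.c := by
    intro e
    obtain ⟨x, y, i, i', l, hx, hy, hi, hi', hX', hY', hC⟩ := hZ.nb_c
    have h1 := (MGraph.ty_succ_eq.1 e).2
    rw [← hZ.c_glue, hC, hY', Multiset.replicate_add] at h1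
    simp only [Multiset.map_add, Multiset.map_replicate, hf, hg, h.ty_c le_rfl] at h1
    have h2 := Multiset.replicate_right_injective hi (add_right_cancel (add_right_cancel h1))
    exact hx ((h.sep _ _).1 h2).1
  obtain ⟨h1, h2, h3, h4⟩ := hY.propagate g hZ.nb_g (fun v _ => hZ.col_g v) (hZ.ty_inj h)
    h.injY hg hne (t := s + M - 1) (by omega)
  refine ⟨by have := h.level; omega, hZ.chain hX hY, ⟨_, hY.rev⟩, hZ.card_nb h.cardX h.cardY,
    h.cardY, h1, h2, ?_, ?_⟩
  · rw [hZ.c_eq]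
    exact h3
  · rw [hZ.c_eq]
    exact h4

/-- Two `(i,j)`-concatenations with a single vertex, with different indices at this vertex. -/
theorem IsIJ.pairInv_of_lt {Z' : MGraph α} {i' : ℕ} {f' : X.Vert → Z'.Vert} {g' : Y.Vert → Z'.Vert}
    (hZ : IsIJ Z X Y f g i j) (hZ' : IsIJ Z' X Y f' g' i' j) (h : PairInv d X Y 1 M s)
    (hi : i ≠ i') (e : Z'.Vert → Z.Vert) (hef : ∀ u, e (f' u) = f u)
    (heg : ∀ v, e (g' v) = g v) : PairInv d Z Z' (1 + M) (1 + M) (2 * M) := by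
  obtain ⟨pX, hX⟩ := h.chX
  obtain ⟨pY, hY⟩ := h.chY
  obtain ⟨hf, hg⟩ := hZ.ty_eq h (s + 1) le_rfl
  obtain ⟨hf', hg'⟩ := hZ'.ty_eq h (s + 1) le_rfl
  obtain ⟨pZ', hC⟩ := hZ'.chain hX hY
  have hlev := h.level
  have hne : Z.ty (s + 1 + 1) (f X.c) ≠ Z'.ty (s + 1 + 1) (f' X.c) := by
    intro e
    have h1 := (MGraph.ty_succ_eq.1 e).2
    have h2 := congrArg (Multiset.map (Z.ty (s + 1))) hZ.nb_fc
    have h3 := congrArg (Multiset.map (Z'.ty (s + 1))) hZ'.nb_fc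
    rw [Multiset.map_add, Multiset.map_add, Multiset.map_replicate, Multiset.map_replicate,
      Multiset.map_map, show Z.ty (s + 1) ∘ f = X.ty (s + 1) from funext hf, h1, hf, hg] at h2
    rw [Multiset.map_add, Multiset.map_add, Multiset.map_replicate, Multiset.map_replicate,
      Multiset.map_map, show Z'.ty (s + 1) ∘ f' = X.ty (s + 1) from funext hf', hf', hg'] at h3
    have h4 := congrArg (Multiset.count (X.ty (s + 1) X.c)) h2
    have h5 := congrArg (Multiset.count (X.ty (s + 1) X.c)) h3
    simp only [Multiset.count_add, Multiset.count_replicate, if_true, if_neg h.ne.symm] at h4 h5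
    omega
  have hB : Function.Injective (Z'.ty (s + 1)) := hZ'.ty_inj h
  have heq : ∀ v, Z.ty (s + 1) (e v) = Z'.ty (s + 1) v := by
    intro v
    rcases hZ'.surj v with ⟨u, rfl⟩ | ⟨v, rfl⟩
    · rw [hef, hf, hf']
    · rw [heg, hg, hg']
  have hXo : X.o = X.c := hX.eq_c X.o
  have hnb : ∀ v, v ≠ Z'.o → Z.nb (e v) = (Z'.nb v).map e := by
    intro v hv
    rcases hZ'.surj v with ⟨u, rfl⟩ | ⟨v, rfl⟩
    · rw [hZ'.o_eq, hXo, hX.eq_c u] at hv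
      exact absurd rfl hv
    · have hcomp : e ∘ g' = g := funext heg
      rw [heg]
      by_cases hv : v = Y.c
      · subst hv
        have h1 := congrArg (Multiset.map e) hZ'.nb_gc
        rw [Multiset.map_add, Multiset.map_add, Multiset.map_replicate, Multiset.map_replicate,
          Multiset.map_map, hcomp, hef, heg, ← hZ.nb_gc] at h1
        exact (add_right_cancel h1).symm
      · rw [hZ.nb_g v hv, hZ'.nb_g v hv, Multiset.map_map, hcomp]
  have hcol : ∀ v, Z.col (e v) = Z'.col v := by
    intro v
    rcases hZ'.surj v with ⟨u, rfl⟩ | ⟨v, rfl⟩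
    · rw [hef, hZ.col_f, hZ'.col_f]
    · rw [heg, hZ.col_g, hZ'.col_g]
  have hne' : Z.ty (s + 1 + 1) (e Z'.o) ≠ Z'.ty (s + 1 + 1) Z'.o := by
    rwa [hZ'.o_eq, hXo, hef]
  obtain ⟨h1, h2, h3, h4⟩ := hC.rev.propagate (Z := Z) e hnb (fun v _ => hcol v)
    (hZ.ty_inj h) hB heq hne' (t := 2 * M) (by omega)
  have hc : e Z'.c = Z.c := by rw [hZ.c_eq, hZ'.c_eq, heg]
  refine ⟨by omega, hZ.chain hX hY, ⟨_, hC⟩, hZ.card_nb h.cardX h.cardY,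
    hZ'.card_nb h.cardX h.cardY, h1, h2, ?_, ?_⟩
  · rw [← hc]
    exact h3
  · rw [← hc]
    exact h4

end Sturm

namespace Sturm

/-! ## Concatenations of edge-indexed graphs as multigraphs -/

variable {V α : Type}

/-- The multiplicity of an element in a multiset. -/
def mult {A : Type} (M : Multiset A) (a : A) : ℕ := M.count a

theorem mult_add {A : Type} (M N : Multiset A) (a : A) : mult (M + N) a = mult M a + mult N a :=
  Multiset.count_add _ _ _

theorem mult_replicate {A : Type} (n : ℕ) (b a : A) :
    mult (Multiset.replicate n b) a = if a = b then n else 0 := by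
  rw [mult, Multiset.count_replicate]
  simp only [eq_comm]

theorem mult_ext {A : Type} {M N : Multiset A} (h : ∀ a, mult M a = mult N a) : M = N :=
  Multiset.ext.2 h

theorem mult_sub {A : Type} [DecidableEq A] (M N : Multiset A) (a : A) :
    mult (M - N) a = mult M a - mult N a := by
  rw [mult, mult, mult]
  convert Multiset.count_sub a M N

theorem mult_map {A B : Type} {f : A → B} (hf : Function.Injective f) (M : Multiset A) (a : A) :
    mult (M.map f) (f a) = mult M a :=
  Multiset.count_map_eq_count' _ _ hf _

theorem mult_map_of_ne {A B : Type} {f : A → B} (M : Multiset A) {b : B} (h : ∀ a, f a ≠ b) :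
    mult (M.map f) b = 0 := by
  rw [mult, Multiset.count_eq_zero, Multiset.mem_map]
  rintro ⟨a, -, e⟩
  exact h a e

theorem mult_map_inl_inl {A B : Type} (M : Multiset A) (a : A) :
    mult (M.map (Sum.inl : A → A ⊕ B)) (Sum.inl a) = mult M a :=
  mult_map Sum.inl_injective _ _

theorem mult_map_inr_inr {A B : Type} (M : Multiset B) (b : B) :
    mult (M.map (Sum.inr : B → A ⊕ B)) (Sum.inr b) = mult M b :=
  mult_map Sum.inr_injective _ _

theorem mult_map_inl_inr {A B : Type} (M : Multiset A) (b : B) :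
    mult (M.map (Sum.inl : A → A ⊕ B)) (Sum.inr b) = 0 :=
  mult_map_of_ne _ fun _ => Sum.inl_ne_inr

theorem mult_map_inr_inl {A B : Type} (M : Multiset B) (a : A) :
    mult (M.map (Sum.inr : B → A ⊕ B)) (Sum.inl a) = 0 :=
  mult_map_of_ne _ fun _ => Sum.inr_ne_inl

/-- The edge-indices at every vertex define a (finite) multiset of neighbors. -/
def EIG.WF (X : EIG V α) : Prop := ∀ v, ∃ M : Multiset X.Vert, ∀ w, mult M w = X.idx v w

/-- The multiset of neighbors of a vertex of an edge-indexed graph. -/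
def EIG.nb (X : EIG V α) (v : X.Vert) : Multiset X.Vert :=
  if h : ∃ M : Multiset X.Vert, ∀ w, mult M w = X.idx v w then h.choose else 0

theorem EIG.WF.mult_nb {X : EIG V α} (h : X.WF) (v w : X.Vert) :
    mult (X.nb v) w = X.idx v w := by
  rw [EIG.nb, dif_pos (h v)]
  exact (h v).choose_spec w

/-- The multigraph underlying a pointed edge-indexed graph. -/
def PtdEIG.mg (P : PtdEIG V α) : MGraph α := ⟨P.gr.Vert, P.gr.nb, P.gr.col, P.c, P.o⟩

theorem IsIJ.symm {X Y Z : MGraph α} {f : X.Vert → Z.Vert} {g : Y.Vert → Z.Vert} {i j : ℕ}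
    (h : IsIJ Z X Y f g i j) : IsIJ Z.rev Y X g f j i where
  f_inj := h.g_inj
  g_inj := h.f_inj
  disj := fun u v e => h.disj v u e.symm
  surj := fun z => (h.surj z).symm
  col_f := h.col_g
  col_g := h.col_f
  nb_f := h.nb_g
  nb_g := h.nb_f
  nb_fc := h.nb_gc
  nb_gc := h.nb_fc
  i_pos := h.j_pos
  j_pos := h.i_pos
  c_eq := h.o_eq
  o_eq := h.c_eq

theorem IsI.symm {X Y Z : MGraph α} {f : X.Vert → Z.Vert} {g : Y.Vert → Z.Vert}
    (h : IsI Z X Y f g) : IsI Z.rev Y X g f where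
  f_inj := h.g_inj
  g_inj := h.f_inj
  c_glue := h.c_glue.symm
  disj := fun u v e => (h.disj v u e.symm).symm
  surj := fun z => (h.surj z).symm
  col_f := h.col_g
  col_g := h.col_f
  nb_f := h.nb_g
  nb_g := h.nb_f
  nb_c := by
    obtain ⟨x, y, i, i', l, hx, hy, hi, hi', hX, hY, hC⟩ := h.nb_c
    refine ⟨y, x, i', i, l, hy, hx, hi', hi, by rw [add_comm i', hY], by rw [add_comm i', hX], ?_⟩
    rw [add_comm (Multiset.replicate i _), h.c_glue] at hC
    exact hC
  c_eq := h.o_eq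
  o_eq := h.c_eq


theorem exists_nb_concatIJ {A B : Type} (NA : A → Multiset A) (NB : B → Multiset B) (a : A) (b : B)
    (i j : ℕ) : ∃ F : A ⊕ B → Multiset (A ⊕ B),
    (∀ u w, mult (F (Sum.inl u)) (Sum.inl w) =
      if u = a ∧ w = a then mult (NA a) a - i else mult (NA u) w) ∧
    (∀ u w, mult (F (Sum.inl u)) (Sum.inr w) = if u = a ∧ w = b then i else 0) ∧
    (∀ u w, mult (F (Sum.inr u)) (Sum.inl w) = if u = b ∧ w = a then j else 0) ∧
    (∀ u w, mult (F (Sum.inr u)) (Sum.inr w) =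
      if u = b ∧ w = b then mult (NB b) b - j else mult (NB u) w) := by
  refine ⟨Sum.elim
    (fun u => ((NA u).map Sum.inl - Multiset.replicate (if u = a then i else 0) (Sum.inl a)) +
      Multiset.replicate (if u = a then i else 0) (Sum.inr b))
    (fun u => ((NB u).map Sum.inr - Multiset.replicate (if u = b then j else 0) (Sum.inr b)) +
      Multiset.replicate (if u = b then j else 0) (Sum.inl a)), ?_, ?_, ?_, ?_⟩ <;> intro u w
  · rw [Sum.elim_inl, mult_add, mult_sub, mult_map_inl_inl, mult_replicate, mult_replicate]
    by_cases hu : u = a <;> by_cases hw : w = a <;> simp [hu, hw]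
  · rw [Sum.elim_inl, mult_add, mult_sub, mult_map_inl_inr, mult_replicate, mult_replicate]
    by_cases hu : u = a <;> by_cases hw : w = b <;> simp [hu, hw]
  · rw [Sum.elim_inr, mult_add, mult_sub, mult_map_inr_inl, mult_replicate, mult_replicate]
    by_cases hu : u = b <;> by_cases hw : w = a <;> simp [hu, hw]
  · rw [Sum.elim_inr, mult_add, mult_sub, mult_map_inr_inr, mult_replicate, mult_replicate]
    by_cases hu : u = b <;> by_cases hw : w = b <;> simp [hu, hw]

theorem concatIJ_wf {X Y : EIG V α} (hX : X.WF) (hY : Y.WF) (v : X.Vert) (v' : Y.Vert) (i j : ℕ) :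
    (concatIJ X Y v v' i j).WF := by
  obtain ⟨F, h1, h2, h3, h4⟩ := exists_nb_concatIJ X.nb Y.nb v v' i j
  simp only [hX.mult_nb] at h1
  simp only [hY.mult_nb] at h4
  intro u
  refine ⟨F u, fun w => ?_⟩
  rcases u with u | u <;> rcases w with w | w
  · exact h1 u w
  · exact h2 u w
  · exact h3 u w
  · exact h4 u w

theorem nb_concatIJ {A B : Type} {NA : A → Multiset A} {NB : B → Multiset B} {a : A} {b : B}
    {i j : ℕ} {F : A ⊕ B → Multiset (A ⊕ B)} {iA : A → A → ℕ} {iB : B → B → ℕ}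
    (hA : ∀ u w, mult (NA u) w = iA u w) (hB : ∀ u w, mult (NB u) w = iB u w)
    (h1 : ∀ u w, mult (F (Sum.inl u)) (Sum.inl w) =
      if u = a ∧ w = a then iA a a - i else iA u w)
    (h2 : ∀ u w, mult (F (Sum.inl u)) (Sum.inr w) = if u = a ∧ w = b then i else 0)
    (h3 : ∀ u w, mult (F (Sum.inr u)) (Sum.inl w) = if u = b ∧ w = a then j else 0)
    (h4 : ∀ u w, mult (F (Sum.inr u)) (Sum.inr w) =
      if u = b ∧ w = b then iB b b - j else iB u w)
    (hi : i ≤ iA a a) (hj : j ≤ iB b b) :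
    (∀ u, u ≠ a → F (Sum.inl u) = (NA u).map Sum.inl) ∧
    (∀ u, u ≠ b → F (Sum.inr u) = (NB u).map Sum.inr) ∧
    F (Sum.inl a) + Multiset.replicate i (Sum.inl a) =
      (NA a).map Sum.inl + Multiset.replicate i (Sum.inr b) ∧
    F (Sum.inr b) + Multiset.replicate j (Sum.inr b) =
      (NB b).map Sum.inr + Multiset.replicate j (Sum.inl a) := by
  refine ⟨fun u hu => mult_ext ?_, fun u hu => mult_ext ?_, mult_ext ?_, mult_ext ?_⟩
  · rintro (w | w)
    · rw [h1, mult_map_inl_inl, hA, if_neg fun h => hu h.1]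
    · rw [h2, mult_map_inl_inr, if_neg fun h => hu h.1]
  · rintro (w | w)
    · rw [h3, mult_map_inr_inl, if_neg fun h => hu h.1]
    · rw [h4, mult_map_inr_inr, hB, if_neg fun h => hu h.1]
  · rintro (w | w)
    · rw [mult_add, mult_add, h1, mult_map_inl_inl, hA, mult_replicate, mult_replicate]
      by_cases hw : w = a <;> simp [hw, hi]
    · rw [mult_add, mult_add, h2, mult_map_inl_inr, mult_replicate, mult_replicate]
      by_cases hw : w = b <;> simp [hw]
  · rintro (w | w)
    · rw [mult_add, mult_add, h3, mult_map_inr_inl, mult_replicate, mult_replicate]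
      by_cases hw : w = a <;> simp [hw]
    · rw [mult_add, mult_add, h4, mult_map_inr_inr, hB, mult_replicate, mult_replicate]
      by_cases hw : w = b <;> simp [hw, hj]

theorem concatIJ_isIJ {X Y : PtdEIG V α} (hX : X.gr.WF) (hY : Y.gr.WF) {i j : ℕ} (hi : i ≠ 0)
    (hj : j ≠ 0) (hi' : i ≤ X.gr.idx X.c X.c) (hj' : j ≤ Y.gr.idx Y.c Y.c) :
    IsIJ (PtdEIG.mg ⟨concatIJ X.gr Y.gr X.c Y.c i j, Sum.inr Y.o, Sum.inl X.o⟩) X.mg Y.mg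
      Sum.inl Sum.inr i j := by
  have hZ := concatIJ_wf hX hY X.c Y.c i j
  obtain ⟨e1, e2, e3, e4⟩ := nb_concatIJ (F := (concatIJ X.gr Y.gr X.c Y.c i j).nb)
    hX.mult_nb hY.mult_nb (fun u w => hZ.mult_nb (Sum.inl u) (Sum.inl w))
    (fun u w => hZ.mult_nb (Sum.inl u) (Sum.inr w))
    (fun u w => hZ.mult_nb (Sum.inr u) (Sum.inl w))
    (fun u w => hZ.mult_nb (Sum.inr u) (Sum.inr w)) hi' hj'
  refine ⟨Sum.inl_injective, Sum.inr_injective, fun u v => Sum.inl_ne_inr, ?_, fun _ => rfl,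
    fun _ => rfl, e1, e2, e3, e4, hi, hj, rfl, rfl⟩
  rintro (u | u)
  · exact Or.inl ⟨u, rfl⟩
  · exact Or.inr ⟨u, rfl⟩

/-- The inclusion of the second graph in an `(i)`-concatenation. -/
def glue {A B : Type} (a : A) (b : B) (w : B) : A ⊕ {w : B // w ≠ b} :=
  if h : w ≠ b then Sum.inr ⟨w, h⟩ else Sum.inl a

theorem glue_self {A B : Type} (a : A) (b : B) : glue a b b = Sum.inl a :=
  dif_neg (not_not.2 rfl)

theorem glue_of_ne {A B : Type} (a : A) (b : B) {w : B} (h : w ≠ b) :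
    glue a b w = Sum.inr ⟨w, h⟩ := dif_pos h

theorem glue_injective {A B : Type} (a : A) (b : B) : Function.Injective (glue a b) := by
  intro w w' e
  by_cases h : w = b <;> by_cases h' : w' = b
  · rw [h, h']
  · rw [h, glue_self, glue_of_ne a b h'] at e
    exact absurd e Sum.inl_ne_inr
  · rw [h', glue_self, glue_of_ne a b h] at e
    exact absurd e Sum.inr_ne_inl
  · rw [glue_of_ne a b h, glue_of_ne a b h'] at e
    exact congrArg Subtype.val (Sum.inr_injective e)


theorem mult_map_glue_inl {A B : Type} (a : A) (b : B) (M : Multiset B) (w : A) :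
    mult (M.map (glue a b)) (Sum.inl w) = if w = a then mult M b else 0 := by
  split_ifs with h
  · rw [h, ← glue_self a b, mult_map (glue_injective a b)]
  · refine mult_map_of_ne _ fun x hx => ?_
    by_cases hxb : x = b
    · rw [hxb, glue_self] at hx
      exact h (Sum.inl_injective hx).symm
    · rw [glue_of_ne a b hxb] at hx
      exact Sum.inr_ne_inl hx

theorem mult_map_glue_inr {A B : Type} (a : A) (b : B) (M : Multiset B) (w : {w : B // w ≠ b}) :
    mult (M.map (glue a b)) (Sum.inr w) = mult M w.1 := by
  rw [← mult_map (glue_injective a b) M w.1, glue_of_ne a b w.2]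

theorem mult_concatI_c {A B : Type} {iA : A → A → ℕ} {iB : B → B → ℕ} {a x : A} {b y : B}
    {m l i : ℕ} (hx : x ≠ a) (hy : y ≠ b)
    (hA : ∀ w, mult (Multiset.replicate m x + Multiset.replicate l a) w = iA a w)
    (hB : ∀ w, mult (Multiset.replicate m y + Multiset.replicate l b) w = iB b w) (him : i < m) :
    (∀ w : A, mult (Multiset.replicate i (Sum.inl x) + Multiset.replicate (m - i)
      (Sum.inr ⟨y, hy⟩) + Multiset.replicate l (Sum.inl a) :
        Multiset (A ⊕ {w : B // w ≠ b})) (Sum.inl w) =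
      if a = a ∧ w ≠ a then (if iA a w = 0 then 0 else i) else iA a w) ∧
    (∀ w : {w : B // w ≠ b}, mult (Multiset.replicate i (Sum.inl x) + Multiset.replicate (m - i)
      (Sum.inr ⟨y, hy⟩) + Multiset.replicate l (Sum.inl a) :
        Multiset (A ⊕ {w : B // w ≠ b})) (Sum.inr w) =
      if a = a then iB b w.1 - i else 0) := by
  constructor
  · intro w
    rw [← hA]
    simp only [mult_add, mult_replicate, Sum.inl.injEq, reduceCtorEq, if_false]
    by_cases hwa : w = a
    · subst hwa
      simp [hx.symm]
    · by_cases hwx : w = x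
      · have : m ≠ 0 := by omega
        simp [hwx, hx, this]
      · simp [hwx, hwa]
  · rintro ⟨w, hw⟩
    rw [← hB]
    simp only [mult_add, mult_replicate, Sum.inr.injEq, reduceCtorEq, if_false, Subtype.mk.injEq]
    by_cases hwy : w = y
    · simp [hwy, hy]
    · simp [hwy, hw]

theorem concatI_wf {X Y : EIG V α} (hX : X.WF) (hY : Y.WF) {v x : X.Vert} {v' y : Y.Vert}
    {m l i : ℕ} (hx : x ≠ v) (hy : y ≠ v')
    (hXc : X.nb v = Multiset.replicate m x + Multiset.replicate l v)
    (hYc : Y.nb v' = Multiset.replicate m y + Multiset.replicate l v') (him : i < m) :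
    (concatI X Y v v' i).WF := by
  have hc := mult_concatI_c hx hy (fun w => hXc ▸ hX.mult_nb v w) (fun w => hYc ▸ hY.mult_nb v' w)
    him
  rintro (u | u)
  · by_cases hu : u = v
    · subst hu
      refine ⟨(Multiset.replicate i (Sum.inl x) + Multiset.replicate (m - i) (Sum.inr ⟨y, hy⟩) +
        Multiset.replicate l (Sum.inl u) : Multiset (X.Vert ⊕ {w : Y.Vert // w ≠ v'})), ?_⟩
      rintro (w | w)
      · exact hc.1 w
      · exact hc.2 w
    · refine ⟨(X.nb u).map Sum.inl, ?_⟩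
      rintro (w | w)
      · refine (mult_map_inl_inl _ _).trans ((hX.mult_nb _ _).trans ?_)
        exact (if_neg fun h => hu h.1).symm
      · exact (mult_map_inl_inr _ _).trans (if_neg hu).symm
  · refine ⟨(Y.nb u.1).map (glue v v'), ?_⟩
    rintro (w | w)
    · refine (mult_map_glue_inl _ _ _ _).trans ?_
      rw [hY.mult_nb]
      rfl
    · exact (mult_map_glue_inr _ _ _ _).trans (hY.mult_nb _ _)

theorem concatI_isI {X Y : PtdEIG V α} (hX : X.gr.WF) (hY : Y.gr.WF) {m l i : ℕ} {x : X.gr.Vert}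
    {y : Y.gr.Vert} (hx : x ≠ X.c) (hy : y ≠ Y.c)
    (hXc : X.gr.nb X.c = Multiset.replicate m x + Multiset.replicate l X.c)
    (hYc : Y.gr.nb Y.c = Multiset.replicate m y + Multiset.replicate l Y.c) (hi : i ≠ 0)
    (him : i < m) (hcol : X.gr.col X.c = Y.gr.col Y.c) :
    IsI (PtdEIG.mg ⟨concatI X.gr Y.gr X.c Y.c i, glue X.c Y.c Y.o, Sum.inl X.o⟩) X.mg Y.mg
      Sum.inl (glue X.c Y.c) := by
  have hZ := concatI_wf hX hY hx hy hXc hYc him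
  have hc := mult_concatI_c hx hy (fun w => hXc ▸ hX.mult_nb X.c w)
    (fun w => hYc ▸ hY.mult_nb Y.c w) him
  refine ⟨Sum.inl_injective, glue_injective _ _, (glue_self _ _).symm, ?_, ?_, fun _ => rfl,
    ?_, ?_, ?_, ⟨x, y, i, m - i, l, hx, hy, hi, by omega, ?_, ?_, ?_⟩, rfl, rfl⟩
  · intro u w e
    by_cases hw : w = Y.c
    · rw [hw] at e
      exact ⟨Sum.inl_injective (e.trans (glue_self _ _)), hw⟩
    · exact absurd (e.trans (glue_of_ne X.c Y.c hw)) Sum.inl_ne_inr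
  · rintro (u | u)
    · exact Or.inl ⟨u, rfl⟩
    · exact Or.inr ⟨u.1, glue_of_ne _ _ u.2⟩
  · intro w
    by_cases hw : w = Y.c
    · rw [hw]
      refine (congrArg (concatI X.gr Y.gr X.c Y.c i).col (glue_self _ _)).trans hcol
    · exact congrArg (concatI X.gr Y.gr X.c Y.c i).col (glue_of_ne _ _ hw)
  · intro u hu
    refine mult_ext (A := X.gr.Vert ⊕ {w : Y.gr.Vert // w ≠ Y.c}) ?_
    rintro (w | w)
    · refine (hZ.mult_nb (Sum.inl u) (Sum.inl w)).trans (Eq.trans ?_ (mult_map_inl_inl _ _).symm)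
      exact (if_neg fun h => hu h.1).trans (hX.mult_nb _ _).symm
    · refine (hZ.mult_nb (Sum.inl u) (Sum.inr w)).trans (Eq.trans ?_ (mult_map_inl_inr _ _).symm)
      exact if_neg hu
  · intro u hu
    refine (congrArg (concatI X.gr Y.gr X.c Y.c i).nb (glue_of_ne _ _ hu)).trans ?_
    refine mult_ext (A := X.gr.Vert ⊕ {w : Y.gr.Vert // w ≠ Y.c}) ?_
    rintro (w | w)
    · refine (hZ.mult_nb (Sum.inr ⟨u, hu⟩) (Sum.inl w)).trans
        (Eq.trans ?_ (mult_map_glue_inl _ _ _ _).symm)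
      exact congrArg (fun t => if w = X.c then t else 0) (hY.mult_nb _ _).symm
    · exact (hZ.mult_nb (Sum.inr ⟨u, hu⟩) (Sum.inr w)).trans
        (Eq.trans (hY.mult_nb _ _).symm (mult_map_glue_inr _ _ _ _).symm)
  · rw [Nat.add_sub_cancel' him.le]
    exact hXc
  · rw [Nat.add_sub_cancel' him.le]
    exact hYc
  · refine mult_ext (A := X.gr.Vert ⊕ {w : Y.gr.Vert // w ≠ Y.c}) ?_
    have e : glue X.c Y.c y = Sum.inr ⟨y, hy⟩ := glue_of_ne _ _ hy
    rw [e]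
    rintro (w | w)
    · exact (hZ.mult_nb (Sum.inl X.c) (Sum.inl w)).trans (hc.1 w).symm
    · exact (hZ.mult_nb (Sum.inl X.c) (Sum.inr w)).trans (hc.2 w).symm

end Sturm

namespace Sturm

/-! ## One step of the construction -/

variable {V α : Type}

/-- The map `f` preserves the types of depth at most `s` and adjacency of distinct vertices. -/
structure IsInclusion (X Z : MGraph α) (f : X.Vert → Z.Vert) (s : ℕ) : Prop where
  ty : ∀ v, ∀ n ≤ s, Z.ty n (f v) = X.ty n v
  mem : ∀ u w, u ≠ w → u ∈ X.nb w → f u ∈ Z.nb (f w)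

theorem IsInclusion.refl (X : MGraph α) (s : ℕ) : IsInclusion X X id s :=
  ⟨fun _ _ _ => rfl, fun _ _ _ h => h⟩

theorem IsInclusion.refl_rev (X : MGraph α) (s : ℕ) : IsInclusion X X.rev id s :=
  ⟨fun _ _ _ => rfl, fun _ _ _ h => h⟩

section

variable {X Y Z : MGraph α} {f : X.Vert → Z.Vert} {g : Y.Vert → Z.Vert} {i j d N M s : ℕ}

theorem IsIJ.isInclusion (hZ : IsIJ Z X Y f g i j) (h : PairInv d X Y N M s) :
    IsInclusion X Z f s ∧ IsInclusion Y Z g s :=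
  ⟨⟨fun v n hn => (hZ.ty_eq h n (by omega)).1 v, hZ.mem_nb.1⟩,
    ⟨fun v n hn => (hZ.ty_eq h n (by omega)).2 v, hZ.mem_nb.2⟩⟩

theorem IsI.isInclusion (hZ : IsI Z X Y f g) (h : PairInv d X Y N M s) :
    IsInclusion X Z f s ∧ IsInclusion Y Z g s :=
  ⟨⟨fun v n hn => (hZ.ty_eq h n hn).1 v, hZ.mem_nb.1⟩,
    ⟨fun v n hn => (hZ.ty_eq h n hn).2 v, hZ.mem_nb.2⟩⟩

theorem MGraph.rev_eq_of_c_eq_o {X : MGraph α} (h : X.c = X.o) : X.rev = X := by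
  obtain ⟨A, nb, col, c, o⟩ := X
  change c = o at h
  subst h
  rfl

end

/-- The outcome of a step: the new pair contains the old one, and has no new types of depth `s`. -/
structure StepOut (d : ℕ) (S : Sys V α) (st : StepRes S) (al : Bool) (s N' M' s' : ℕ) : Prop where
  side : ∀ x y, y = x ∨ y = al → IsInclusion (Fside S x).mg (Fside st.next y).mg (st.sel x y) s
  cover : ∀ y (v : (Fside st.next y).mg.Vert), ∃ x, ∃ u : (Fside S x).mg.Vert, ∀ n ≤ s,
    (Fside S x).mg.ty n u = (Fside st.next y).mg.ty n v
  lt : s < s'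
  big : s + 1 ≤ if al = true then N' else M'

theorem stepOut_true {d : ℕ} {S : Sys V α} {st : StepRes S} {s N' M' s' : ℕ}
    (hA : IsInclusion S.FA.mg st.next.FA.mg st.embA s)
    (hBA : IsInclusion S.FB.mg st.next.FA.mg st.crossBA s)
    (hB : IsInclusion S.FB.mg st.next.FB.mg st.embB s)
    (hsA : ∀ z, (∃ u, st.embA u = z) ∨ ∃ v, st.crossBA v = z)
    (hsB : ∀ z : st.next.FB.mg.Vert, ∃ x, ∃ u : (Fside S x).mg.Vert, ∀ n ≤ s,
      (Fside S x).mg.ty n u = st.next.FB.mg.ty n z)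
    (lt : s < s') (big : s + 1 ≤ N') :
    StepOut d S st true s N' M' s' := by
  refine ⟨?_, ?_, lt, by simpa using big⟩
  · rintro (_ | _) (_ | _) h
    · exact hB
    · exact hBA
    · simp at h
    · exact hA
  · rintro (_ | _) v
    · exact hsB v
    · rcases hsA v with ⟨u, rfl⟩ | ⟨u, rfl⟩
      · exact ⟨true, u, fun n hn => (hA.ty u n hn).symm⟩
      · exact ⟨false, u, fun n hn => (hBA.ty u n hn).symm⟩

theorem stepOut_false {d : ℕ} {S : Sys V α} {st : StepRes S} {s N' M' s' : ℕ}
    (hA : IsInclusion S.FA.mg st.next.FA.mg st.embA s)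
    (hAB : IsInclusion S.FA.mg st.next.FB.mg st.crossAB s)
    (hB : IsInclusion S.FB.mg st.next.FB.mg st.embB s)
    (hsA : ∀ z, ∃ u, st.embA u = z)
    (hsB : ∀ z, (∃ u, st.crossAB u = z) ∨ ∃ v, st.embB v = z)
    (lt : s < s') (big : s + 1 ≤ M') :
    StepOut d S st false s N' M' s' := by
  refine ⟨?_, ?_, lt, by simpa using big⟩
  · rintro (_ | _) (_ | _) h
    · exact hB
    · simp at h
    · exact hAB
    · exact hA
  · rintro (_ | _) v
    · rcases hsB v with ⟨u, rfl⟩ | ⟨u, rfl⟩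
      · exact ⟨true, u, fun n hn => (hAB.ty u n hn).symm⟩
      · exact ⟨false, u, fun n hn => (hB.ty u n hn).symm⟩
    · obtain ⟨u, rfl⟩ := hsA v
      exact ⟨true, u, fun n hn => (hA.ty u n hn).symm⟩

/-- The invariants of the pair `(F^A_{k-1}, F^B_{k-1})`. -/
structure SysInv (d : ℕ) (αs : ℕ → Bool) (idat : ℕ → IdxData) (k : ℕ) (S : Sys V α)
    (N M s : ℕ) : Prop where
  wfA : S.FA.gr.WF
  wfB : S.FB.gr.WF
  inv : PairInv d S.FA.mg S.FB.mg N M s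
  initial : (∀ j < k, αs j = false) → N = 1 ∧ S.FA.gr.idx S.FA.c S.FA.c = d ∧
    S.FB.gr.idx S.FB.c S.FB.c + (if k = 0 then 0 else (idat (k - 1)).iOf) = d ∧
    (k ≠ 0 → 2 ≤ M ∧ S.FB.gr.idx S.FB.o S.FB.o + (idat 0).jOf = d) ∧
    (k = 0 → S.FB.o = S.FB.c)
  later : GtK αs k → 2 ≤ N ∧ 2 ≤ M ∧
    S.FA.gr.idx S.FA.o S.FA.o + (frak αs idat (k - 1)).1 = d ∧
    S.FB.gr.idx S.FB.o S.FB.o + (frak αs idat (k - 1)).2.1 = d ∧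
    S.FA.gr.idx S.FA.c S.FA.c + (frak αs idat (k - 1)).2.2 = d ∧
    S.FB.gr.idx S.FB.c S.FB.c + (frak αs idat (k - 1)).2.2 = d

theorem baseEIG_wf (x : α) (d : ℕ) : (baseEIG V x d).WF := fun v =>
  ⟨Multiset.replicate d v, fun w => (mult_replicate d v w).trans (if_pos (rfl : (w : PUnit) = v))⟩

theorem baseEIG_nb (x : α) (d : ℕ) (v : (baseEIG V x d).Vert) :
    (baseEIG V x d).nb v = Multiset.replicate d v :=
  mult_ext fun w => ((baseEIG_wf x d).mult_nb v w).trans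
    ((mult_replicate d v w).trans (if_pos (rfl : (w : PUnit) = v))).symm

theorem baseSys_inv {a b : α} (hab : a ≠ b) {d : ℕ} (αs : ℕ → Bool)
    (idat : ℕ → IdxData) : SysInv d αs idat 0 (baseSys V a b d) 1 1 0 := by
  have hch : ∀ x : α, ∃ pos, Chain
      (PtdEIG.mg (⟨baseEIG V x d, PUnit.unit, PUnit.unit⟩ : PtdEIG V α)) 1 pos := fun x => by
    refine ⟨fun _ => 0, fun _ _ _ => rfl, fun _ => by omega, fun n hn => ⟨PUnit.unit, by omega⟩,
      rfl, rfl, fun _ _ _ => by omega, fun _ _ e => by simp at e⟩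
  have hcard : ∀ x : α, ∀ v, ((PtdEIG.mg
      (⟨baseEIG V x d, PUnit.unit, PUnit.unit⟩ : PtdEIG V α)).nb v).card = d := fun x v =>
    (congrArg Multiset.card (baseEIG_nb x d v)).trans (Multiset.card_replicate _ _)
  refine ⟨baseEIG_wf a d, baseEIG_wf b d, ⟨rfl, hch a, hch b, hcard a, hcard b,
    fun _ _ _ => rfl, fun _ _ _ => rfl, fun u v => ⟨fun _ => ⟨rfl, rfl⟩, fun _ => rfl⟩, ?_⟩,
    fun _ => ⟨rfl, rfl, rfl, fun h => absurd rfl h, fun _ => rfl⟩, ?_⟩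
  · intro e
    exact hab (MGraph.ty_succ_eq.1 e).1
  · rintro ⟨j, hj, -⟩
    omega

section

variable {X Y : EIG V α} {v : X.Vert} {v' : Y.Vert} {i j : ℕ}

theorem concatIJ_idx_inl_self :
    (concatIJ X Y v v' i j).idx (Sum.inl v) (Sum.inl v) = X.idx v v - i :=
  if_pos ⟨rfl, rfl⟩

theorem concatIJ_idx_inl {u : X.Vert} (h : u ≠ v) (w : X.Vert) :
    (concatIJ X Y v v' i j).idx (Sum.inl u) (Sum.inl w) = X.idx u w :=
  if_neg fun e => h e.1

theorem concatIJ_idx_inr_self :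
    (concatIJ X Y v v' i j).idx (Sum.inr v') (Sum.inr v') = Y.idx v' v' - j :=
  if_pos ⟨rfl, rfl⟩

theorem concatIJ_idx_inr {u : Y.Vert} (h : u ≠ v') (w : Y.Vert) :
    (concatIJ X Y v v' i j).idx (Sum.inr u) (Sum.inr w) = Y.idx u w :=
  if_neg fun e => h e.1

theorem concatI_idx_inl {u : X.Vert} (h : u ≠ v) (w : X.Vert) :
    (concatI X Y v v' i).idx (Sum.inl u) (Sum.inl w) = X.idx u w :=
  if_neg fun e => h e.1

theorem concatI_idx_glue {u : Y.Vert} (h : u ≠ v') :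
    (concatI X Y v v' i).idx (glue v v' u) (glue v v' u) = Y.idx u u := by
  have e : glue v v' u = Sum.inr ⟨u, h⟩ := glue_of_ne _ _ h
  rw [e]
  rfl

end

section

variable {d : ℕ} {αs : ℕ → Bool} {idat : ℕ → IdxData} {k : ℕ} {S : Sys V α} {N M s : ℕ}

theorem SysInv.pos (h : SysInv d αs idat k S N M s) : 1 ≤ N ∧ 1 ≤ M := by
  obtain ⟨pX, hX⟩ := h.inv.chX
  obtain ⟨pY, hY⟩ := h.inv.chY
  exact ⟨by have := hX.pos_o; omega, by have := hY.pos_o; omega⟩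

theorem SysInv.FA_o_ne_c (h : SysInv d αs idat k S N M s) (hN : 2 ≤ N) : S.FA.o ≠ S.FA.c :=
  h.inv.chX.elim fun _ hX => hX.o_ne_c hN

theorem SysInv.FB_o_ne_c (h : SysInv d αs idat k S N M s) (hM : 2 ≤ M) : S.FB.o ≠ S.FB.c :=
  h.inv.chY.elim fun _ hY => hY.o_ne_c hM

theorem SysInv.FA_o_eq_c (h : SysInv d αs idat k S 1 M s) : S.FA.o = S.FA.c :=
  h.inv.chX.elim fun _ hX => hX.eq_c _

theorem step_of_ltK (h : SysInv d αs idat k S N M s) (hk : LtK αs k)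
    (hadm : ∃ i j, idat k = .two i j ∧ 1 ≤ i ∧ i < d ∧ 1 ≤ j ∧
      j ≤ d - (if k = 0 then 0 else (idat (k - 1)).iOf)) :
    ∃ N' M' s', SysInv d αs idat (k + 1) (Fstep αs idat k S).next N' M' s' ∧
      StepOut d S (Fstep αs idat k S) (αs k) s N' M' s' := by
  obtain ⟨i, j, hid, hi, hid', hj, hj'⟩ := hadm
  obtain ⟨rfl, hA, hB, hB', hB0⟩ := h.initial fun j hj => hk j hj.le
  have hoc := h.FA_o_eq_c
  have hM := h.pos.2
  have hst : Fstep αs idat k S =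
      { next := { FA := S.FA,
                  FB := ⟨concatIJ S.FA.gr S.FB.gr S.FA.c S.FB.c i j,
                         Sum.inl S.FA.c, Sum.inr S.FB.o⟩ },
        embA := id, embB := Sum.inr, crossAB := Sum.inl, crossBA := fun _ => S.FA.c } := by
    rw [Fstep, if_pos hk, hid]
  rw [hst, hk k le_rfl]
  have hZ : IsIJ (PtdEIG.mg ⟨concatIJ S.FA.gr S.FB.gr S.FA.c S.FB.c i j,
      Sum.inl S.FA.c, Sum.inr S.FB.o⟩) S.FB.mg S.FA.mg Sum.inr Sum.inl j i := by
    have h1 := (concatIJ_isIJ h.wfA h.wfB (i := i) (j := j) (by omega) (by omega) (by omega)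
      (by omega)).symm
    rw [← hoc] at h1 ⊢
    exact h1
  have hinv : PairInv d S.FA.mg (PtdEIG.mg ⟨concatIJ S.FA.gr S.FB.gr S.FA.c S.FB.c i j,
      Sum.inl S.FA.c, Sum.inr S.FB.o⟩) 1 (M + 1) (s + 1) := by
    have h1 := (hZ.pairInv h.inv.symm).symm
    rwa [MGraph.rev_eq_of_c_eq_o (X := S.FA.mg) hoc.symm] at h1
  have hwf := concatIJ_wf h.wfA h.wfB S.FA.c S.FB.c i j
  have hincl := hZ.isInclusion h.inv.symm
  refine ⟨1, M + 1, s + 1, ⟨h.wfA, hwf, hinv, fun _ => ⟨rfl, hA, ?_, fun _ => ⟨by omega, ?_⟩,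
      fun h => absurd h (Nat.succ_ne_zero k)⟩, ?_⟩,
    stepOut_false (.refl _ _) hincl.2 hincl.1 (fun z => ⟨z, rfl⟩)
      (fun z => (hZ.surj z).symm) (by omega) ?_⟩
  · refine (congrArg (· + _) concatIJ_idx_inl_self).trans ?_
    rw [if_neg (Nat.succ_ne_zero k), Nat.add_sub_cancel, hid, hA]
    simp only [IdxData.iOf]
    omega
  · by_cases hk0 : k = 0
    · have hidx : (concatIJ S.FA.gr S.FB.gr S.FA.c S.FB.c i j).idx (Sum.inr S.FB.o)
          (Sum.inr S.FB.o) = S.FB.gr.idx S.FB.c S.FB.c - j := by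
        rw [hB0 hk0]
        exact concatIJ_idx_inr_self
      refine (congrArg (· + _) hidx).trans ?_
      subst hk0
      simp only [if_pos] at hB hj'
      simp only [hid, IdxData.jOf]
      omega
    · obtain ⟨hM2, hB'⟩ := hB' hk0
      exact (congrArg (· + _) (concatIJ_idx_inr (h.FB_o_ne_c hM2) _)).trans hB'
  · rintro ⟨j, hj, hj'⟩
    rw [hk j (by omega)] at hj'
    exact absurd hj' (by simp)
  · have := h.inv.level
    omega

theorem step_of_isK_two (h : SysInv d αs idat k S N M s) (hk : IsK αs k) (hk0 : k ≠ 0) {i j : ℕ}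
    (hid : idat k = .two i j) (hi : 1 ≤ i) (hi' : i ≤ d) (hj : 1 ≤ j)
    (hj' : j ≤ d - (idat (k - 1)).iOf) :
    ∃ N' M' s', SysInv d αs idat (k + 1) (Fstep αs idat k S).next N' M' s' ∧
      StepOut d S (Fstep αs idat k S) (αs k) s N' M' s' := by
  obtain ⟨rfl, hA, hB, hB', hB0⟩ := h.initial hk.2
  obtain ⟨hM, hBo⟩ := hB' hk0
  rw [if_neg hk0] at hB
  have hoc := h.FA_o_eq_c
  have hlt : ¬ LtK αs k := fun e => by simpa [hk.1] using e k le_rfl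
  have hst : Fstep αs idat k S =
      { next := { FA := ⟨concatIJ S.FA.gr S.FB.gr S.FA.c S.FB.c i j,
                         Sum.inr S.FB.o, Sum.inl S.FA.o⟩,
                  FB := ⟨S.FB.gr, S.FB.o, S.FB.c⟩ },
        embA := Sum.inl, embB := id, crossAB := fun _ => S.FB.o, crossBA := Sum.inr } := by
    rw [Fstep, if_neg hlt, if_pos hk, hid]
  rw [hst, hk.1]
  have hZ := concatIJ_isIJ h.wfA h.wfB (i := i) (j := j) (by omega) (by omega) (by omega)
    (by omega)
  have hinv := hZ.pairInv h.inv
  have hwf := concatIJ_wf h.wfA h.wfB S.FA.c S.FB.c i j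
  have hincl := hZ.isInclusion h.inv
  have hlev := h.inv.level
  have hfrak : frak αs idat k = (i, (idat (k - 1)).iOf, (idat 0).jOf) := by
    obtain ⟨k, rfl⟩ := Nat.exists_eq_succ_of_ne_zero hk0
    change (if IsK αs (k + 1) then frakBase idat (k + 1) else _) = _
    rw [if_pos hk]
    simp [frakBase, hid]
  refine ⟨1 + M, M, s + M, ⟨hwf, h.wfB, hinv, fun e => ?_, fun _ => ?_⟩,
    stepOut_true hincl.1 hincl.2 (.refl_rev _ _) hZ.surj
      (fun z => ⟨false, z, fun _ _ => rfl⟩) (by omega) (by omega)⟩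
  · have := e k (by omega)
    simp [hk.1] at this
  · rw [Nat.add_sub_cancel, hfrak]
    refine ⟨by omega, hM, ?_, hB, ?_, hBo⟩
    · have hidx : (concatIJ S.FA.gr S.FB.gr S.FA.c S.FB.c i j).idx (Sum.inl S.FA.o)
          (Sum.inl S.FA.o) = S.FA.gr.idx S.FA.c S.FA.c - i := by
        rw [hoc]
        exact concatIJ_idx_inl_self
      refine (congrArg (· + _) hidx).trans ?_
      simp only [hA]
      omega
    · exact (congrArg (· + _) (concatIJ_idx_inr (h.FB_o_ne_c hM) _)).trans hBo

theorem step_of_isK_three (h : SysInv d αs idat k S N M s) (hk : IsK αs k) {i i' j : ℕ}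
    (hid : idat k = .three i i' j) (hi : 1 ≤ i) (hii : i < i') (hi' : i' ≤ d) (hj : 1 ≤ j)
    (hj' : j ≤ d - (if k = 0 then 0 else (idat (k - 1)).iOf)) :
    ∃ N' M' s', SysInv d αs idat (k + 1) (Fstep αs idat k S).next N' M' s' ∧
      StepOut d S (Fstep αs idat k S) (αs k) s N' M' s' := by
  obtain ⟨rfl, hA, hB, hB', hB0⟩ := h.initial hk.2
  have hM := h.pos.2
  have hoc := h.FA_o_eq_c
  have hlt : ¬ LtK αs k := fun e => by simpa [hk.1] using e k le_rfl
  have hst : Fstep αs idat k S =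
      { next := { FA := ⟨concatIJ S.FA.gr S.FB.gr S.FA.c S.FB.c i j,
                         Sum.inr S.FB.o, Sum.inl S.FA.o⟩,
                  FB := ⟨concatIJ S.FA.gr S.FB.gr S.FA.c S.FB.c i' j,
                         Sum.inr S.FB.o, Sum.inl S.FA.o⟩ },
        embA := Sum.inl, embB := Sum.inr, crossAB := Sum.inl, crossBA := Sum.inr } := by
    rw [Fstep, if_neg hlt, if_pos hk, hid]
  rw [hst, hk.1]
  have hZ := concatIJ_isIJ h.wfA h.wfB (i := i) (j := j) (by omega) (by omega) (by omega)
    (by omega)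
  have hZ' := concatIJ_isIJ h.wfA h.wfB (i := i') (j := j) (by omega) (by omega) (by omega)
    (by omega)
  have hinv := hZ.pairInv_of_lt hZ' h.inv hii.ne id (fun _ => rfl) (fun _ => rfl)
  have hwf := concatIJ_wf h.wfA h.wfB S.FA.c S.FB.c i j
  have hwf' := concatIJ_wf h.wfA h.wfB S.FA.c S.FB.c i' j
  have hincl := hZ.isInclusion h.inv
  have hincl' := hZ'.isInclusion h.inv
  have hlev := h.inv.level
  have hfrak : frak αs idat k = (i, i', (idat 0).jOf) := by
    rcases Nat.eq_zero_or_pos k with rfl | hk0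
    · change (if αs 0 = true then frakBase idat 0 else _) = _
      rw [if_pos hk.1]
      simp [frakBase, hid]
    · obtain ⟨k, rfl⟩ := Nat.exists_eq_succ_of_ne_zero hk0.ne'
      change (if IsK αs (k + 1) then frakBase idat (k + 1) else _) = _
      rw [if_pos hk]
      simp [frakBase, hid]
  have hl : ∀ r, (concatIJ S.FA.gr S.FB.gr S.FA.c S.FB.c r j).idx (Sum.inl S.FA.o)
      (Sum.inl S.FA.o) = S.FA.gr.idx S.FA.c S.FA.c - r := fun r => by
    rw [hoc]
    exact concatIJ_idx_inl_self
  have hr : ∀ r, (concatIJ S.FA.gr S.FB.gr S.FA.c S.FB.c r j).idx (Sum.inr S.FB.o)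
      (Sum.inr S.FB.o) + (idat 0).jOf = d := fun r => by
    by_cases hk0 : k = 0
    · have hidx : (concatIJ S.FA.gr S.FB.gr S.FA.c S.FB.c r j).idx (Sum.inr S.FB.o)
          (Sum.inr S.FB.o) = S.FB.gr.idx S.FB.c S.FB.c - j := by
        rw [hB0 hk0]
        exact concatIJ_idx_inr_self
      rw [hidx]
      subst hk0
      simp only [if_pos] at hB hj'
      simp only [hid, IdxData.jOf]
      omega
    · obtain ⟨hM2, hB'⟩ := hB' hk0
      exact (congrArg (· + _) (concatIJ_idx_inr (h.FB_o_ne_c hM2) _)).trans hB'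
  refine ⟨1 + M, 1 + M, 2 * M, ⟨hwf, hwf', hinv, fun e => ?_, fun _ => ?_⟩,
    stepOut_true hincl.1 hincl.2 hincl'.2 hZ.surj (fun z => ?_)
      (by omega) (by omega)⟩
  · have := e k (by omega)
    simp [hk.1] at this
  · rw [Nat.add_sub_cancel, hfrak]
    refine ⟨by omega, by omega, ?_, ?_, hr i, hr i'⟩
    · refine (congrArg (· + _) (hl i)).trans ?_
      simp only [hA]
      omega
    · refine (congrArg (· + _) (hl i')).trans ?_
      simp only [hA]
      omega
  · rcases hZ'.surj z with ⟨u, rfl⟩ | ⟨u, rfl⟩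
    · exact ⟨true, u, fun n hn => (hincl'.1.ty u n hn).symm⟩
    · exact ⟨false, u, fun n hn => (hincl'.2.ty u n hn).symm⟩

theorem frak_of_gtK (hk : GtK αs k) : frak αs idat k =
    if αs k = true then ((frak αs idat (k - 1)).1, (frak αs idat (k - 1)).2.2,
      (frak αs idat (k - 1)).2.1)
    else ((frak αs idat (k - 1)).2.2, (frak αs idat (k - 1)).2.1, (frak αs idat (k - 1)).1) := by
  obtain ⟨k, rfl⟩ : ∃ m, k = m + 1 := by
    obtain ⟨j, hj, -⟩ := hk
    exact ⟨k - 1, by omega⟩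
  have hK : ¬ IsK αs (k + 1) := by
    rintro ⟨-, h⟩
    obtain ⟨j, hj, hj'⟩ := hk
    simp [h j hj] at hj'
  rw [Nat.add_sub_cancel]
  change (if IsK αs (k + 1) then _ else if GtK αs (k + 1) then _ else _) = _
  rw [if_neg hK, if_pos hk]
  rfl

theorem SysInv.exists_nb_c (h : SysInv d αs idat k S N M s) (hN : 2 ≤ N) (hM : 2 ≤ M) {m : ℕ}
    (hA : S.FA.gr.idx S.FA.c S.FA.c + m = d) (hB : S.FB.gr.idx S.FB.c S.FB.c + m = d) :
    ∃ x y l, x ≠ S.FA.c ∧ y ≠ S.FB.c ∧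
      S.FA.gr.nb S.FA.c = Multiset.replicate m x + Multiset.replicate l S.FA.c ∧
      S.FB.gr.nb S.FB.c = Multiset.replicate m y + Multiset.replicate l S.FB.c ∧
      S.FA.gr.col S.FA.c = S.FB.gr.col S.FB.c := by
  obtain ⟨pX, hX⟩ := h.inv.chX
  obtain ⟨pY, hY⟩ := h.inv.chY
  obtain ⟨(x : S.FA.gr.Vert), hx, ex⟩ := hX.exists_nb_c hN
  obtain ⟨(y : S.FB.gr.Vert), hy, ey⟩ := hY.exists_nb_c hM
  have lx : (S.FA.gr.nb S.FA.c).count S.FA.c = S.FA.gr.idx S.FA.c S.FA.c := h.wfA.mult_nb _ _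
  have ly : (S.FB.gr.nb S.FB.c).count S.FB.c = S.FB.gr.idx S.FB.c S.FB.c := h.wfB.mult_nb _ _
  have cx : (S.FA.gr.nb S.FA.c).card = d := h.inv.cardX _
  have cy : (S.FB.gr.nb S.FB.c).card = d := h.inv.cardY _
  replace ex : S.FA.gr.nb S.FA.c = Multiset.replicate ((S.FA.gr.nb S.FA.c).card -
    (S.FA.gr.nb S.FA.c).count S.FA.c) x + Multiset.replicate
      ((S.FA.gr.nb S.FA.c).count S.FA.c) S.FA.c := ex
  replace ey : S.FB.gr.nb S.FB.c = Multiset.replicate ((S.FB.gr.nb S.FB.c).card -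
    (S.FB.gr.nb S.FB.c).count S.FB.c) y + Multiset.replicate
      ((S.FB.gr.nb S.FB.c).count S.FB.c) S.FB.c := ey
  rw [cx, lx] at ex
  rw [cy, ly] at ey
  rw [show d - S.FA.gr.idx S.FA.c S.FA.c = m by omega] at ex
  rw [show d - S.FB.gr.idx S.FB.c S.FB.c = m by omega,
    show S.FB.gr.idx S.FB.c S.FB.c = S.FA.gr.idx S.FA.c S.FA.c by omega] at ey
  have hlev := h.inv.level
  exact ⟨x, y, _, hx, hy, ex, ey, (MGraph.ty_succ_eq.1 (h.inv.ty_c (n := 0 + 1) (by omega))).1⟩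

theorem step_of_gtK_two_true (h : SysInv d αs idat k S N M s) (hk : GtK αs k) (hal : αs k = true) {i j : ℕ}
    (hid : idat k = .two i j) (hi : 1 ≤ i) (hi' : i ≤ d - frakC αs idat (k - 1)) (hj : 1 ≤ j)
    (hj' : j ≤ d - frakC αs idat (k - 1)) :
    ∃ N' M' s', SysInv d αs idat (k + 1) (Fstep αs idat k S).next N' M' s' ∧
      StepOut d S (Fstep αs idat k S) (αs k) s N' M' s' := by
  obtain ⟨hN, hM, hAo, hBo, hAc, hBc⟩ := h.later hk
  have hAoc := h.FA_o_ne_c hN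
  have hBoc := h.FB_o_ne_c hM
  have hlt : ¬ LtK αs k := fun e => by
    obtain ⟨j, hj, hj'⟩ := hk
    simp [e j hj.le] at hj'
  have hK : ¬ IsK αs k := fun e => by
    obtain ⟨j, hj, hj'⟩ := hk
    simp [e.2 j hj] at hj'
  have hini : ¬ ∀ j < k + 1, αs j = false := fun e => by
    obtain ⟨j, hj, hj'⟩ := hk
    simp [e j (by omega)] at hj'
  have hlev := h.inv.level
  have hfrak := frak_of_gtK (idat := idat) hk
  rw [if_pos hal] at hfrak
  rw [frakC] at hi' hj'
  have hst : Fstep αs idat k S =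
      { next := { FA := ⟨concatIJ S.FA.gr S.FB.gr S.FA.c S.FB.c i j,
                         Sum.inr S.FB.o, Sum.inl S.FA.o⟩,
                  FB := ⟨S.FB.gr, S.FB.o, S.FB.c⟩ },
        embA := Sum.inl, embB := id, crossAB := fun _ => S.FB.o, crossBA := Sum.inr } := by
    rw [Fstep, if_neg hlt, if_neg hK, if_pos hal, hid]
  rw [hst, hal]
  have hZ := concatIJ_isIJ h.wfA h.wfB (i := i) (j := j) (by omega) (by omega) (by omega)
    (by omega)
  have hwf := concatIJ_wf h.wfA h.wfB S.FA.c S.FB.c i j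
  have hinv := hZ.pairInv h.inv
  have hincl := hZ.isInclusion h.inv
  refine ⟨N + M, M, s + M, ⟨hwf, h.wfB, hinv, fun e => absurd e hini, fun _ => ?_⟩,
    stepOut_true hincl.1 hincl.2 (.refl_rev _ _) hZ.surj
      (fun z => ⟨false, z, fun _ _ => rfl⟩) (by omega) (by omega)⟩
  rw [Nat.add_sub_cancel, hfrak]
  exact ⟨by omega, hM, (congrArg (· + _) (concatIJ_idx_inl hAoc _)).trans hAo, hBc,
    (congrArg (· + _) (concatIJ_idx_inr hBoc _)).trans hBo, hBo⟩

theorem step_of_gtK_two_false (h : SysInv d αs idat k S N M s) (hk : GtK αs k) (hal : ¬ αs k = true) {i j : ℕ}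
    (hid : idat k = .two i j) (hi : 1 ≤ i) (hi' : i ≤ d - frakC αs idat (k - 1)) (hj : 1 ≤ j)
    (hj' : j ≤ d - frakC αs idat (k - 1)) :
    ∃ N' M' s', SysInv d αs idat (k + 1) (Fstep αs idat k S).next N' M' s' ∧
      StepOut d S (Fstep αs idat k S) (αs k) s N' M' s' := by
  obtain ⟨hN, hM, hAo, hBo, hAc, hBc⟩ := h.later hk
  have hAoc := h.FA_o_ne_c hN
  have hBoc := h.FB_o_ne_c hM
  have hlt : ¬ LtK αs k := fun e => by
    obtain ⟨j, hj, hj'⟩ := hk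
    simp [e j hj.le] at hj'
  have hK : ¬ IsK αs k := fun e => by
    obtain ⟨j, hj, hj'⟩ := hk
    simp [e.2 j hj] at hj'
  have hini : ¬ ∀ j < k + 1, αs j = false := fun e => by
    obtain ⟨j, hj, hj'⟩ := hk
    simp [e j (by omega)] at hj'
  have hlev := h.inv.level
  have hfrak := frak_of_gtK (idat := idat) hk
  rw [if_neg hal] at hfrak
  rw [frakC] at hi' hj'
  have hst : Fstep αs idat k S =
      { next := { FA := ⟨S.FA.gr, S.FA.o, S.FA.c⟩,
                  FB := ⟨concatIJ S.FA.gr S.FB.gr S.FA.c S.FB.c i j,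
                         Sum.inl S.FA.o, Sum.inr S.FB.o⟩ },
        embA := id, embB := Sum.inr, crossAB := Sum.inl, crossBA := fun _ => S.FA.o } := by
    rw [Fstep, if_neg hlt, if_neg hK, if_neg hal, hid]
  rw [hst, eq_false_of_ne_true hal]
  have hZ := concatIJ_isIJ h.wfA h.wfB (i := i) (j := j) (by omega) (by omega) (by omega)
    (by omega)
  have hwf := concatIJ_wf h.wfA h.wfB S.FA.c S.FB.c i j
  have hinv := (hZ.symm.pairInv h.inv.symm).symm
  have hincl := hZ.symm.isInclusion h.inv.symm
  refine ⟨N, M + N, s + N, ⟨h.wfA, hwf, hinv, fun e => absurd e hini, fun _ => ?_⟩,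
    stepOut_false (.refl_rev _ _) hincl.2 hincl.1 (fun z => ⟨z, rfl⟩)
      hZ.surj (by omega) (by omega)⟩
  rw [Nat.add_sub_cancel, hfrak]
  exact ⟨hN, by omega, hAc, (congrArg (· + _) (concatIJ_idx_inr hBoc _)).trans hBo, hAo,
    (congrArg (· + _) (concatIJ_idx_inl hAoc _)).trans hAo⟩

theorem step_of_gtK_one_true (h : SysInv d αs idat k S N M s) (hk : GtK αs k) (hal : αs k = true) {i : ℕ}
    (hid : idat k = .one i) (hi : 1 ≤ i) (hi' : i < frakC αs idat (k - 1)) :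
    ∃ N' M' s', SysInv d αs idat (k + 1) (Fstep αs idat k S).next N' M' s' ∧
      StepOut d S (Fstep αs idat k S) (αs k) s N' M' s' := by
  obtain ⟨hN, hM, hAo, hBo, hAc, hBc⟩ := h.later hk
  have hAoc := h.FA_o_ne_c hN
  have hBoc := h.FB_o_ne_c hM
  have hlt : ¬ LtK αs k := fun e => by
    obtain ⟨j, hj, hj'⟩ := hk
    simp [e j hj.le] at hj'
  have hK : ¬ IsK αs k := fun e => by
    obtain ⟨j, hj, hj'⟩ := hk
    simp [e.2 j hj] at hj'
  have hini : ¬ ∀ j < k + 1, αs j = false := fun e => by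
    obtain ⟨j, hj, hj'⟩ := hk
    simp [e j (by omega)] at hj'
  have hlev := h.inv.level
  have hfrak := frak_of_gtK (idat := idat) hk
  rw [if_pos hal] at hfrak
  rw [frakC] at hi'
  have hst : Fstep αs idat k S =
      { next := { FA := ⟨concatI S.FA.gr S.FB.gr S.FA.c S.FB.c i,
                         glue S.FA.c S.FB.c S.FB.o, Sum.inl S.FA.o⟩,
                  FB := ⟨S.FB.gr, S.FB.o, S.FB.c⟩ },
        embA := Sum.inl, embB := id, crossAB := fun _ => S.FB.o,
        crossBA := glue S.FA.c S.FB.c } := by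
    rw [Fstep, if_neg hlt, if_neg hK, if_pos hal, hid]
    rfl
  rw [hst, hal]
  obtain ⟨x, y, l, hx, hy, hXc, hYc, hcol⟩ := h.exists_nb_c hN hM hAc hBc
  have hZ := concatI_isI h.wfA h.wfB hx hy hXc hYc (by omega) hi' hcol
  have hwf := concatI_wf h.wfA h.wfB hx hy hXc hYc hi'
  have hinv := hZ.pairInv h.inv
  have hincl := hZ.isInclusion h.inv
  refine ⟨N + M - 1, M, s + M - 1, ⟨hwf, h.wfB, hinv, fun e => absurd e hini, fun _ => ?_⟩,
    stepOut_true hincl.1 hincl.2 (.refl_rev _ _) hZ.surj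
      (fun z => ⟨false, z, fun _ _ => rfl⟩) (by omega) (by omega)⟩
  rw [Nat.add_sub_cancel, hfrak]
  exact ⟨by omega, hM, (congrArg (· + _) (concatI_idx_inl hAoc _)).trans hAo, hBc,
    (congrArg (· + _) (concatI_idx_glue hBoc)).trans hBo, hBo⟩

theorem step_of_gtK_one_false (h : SysInv d αs idat k S N M s) (hk : GtK αs k) (hal : ¬ αs k = true) {i : ℕ}
    (hid : idat k = .one i) (hi : 1 ≤ i) (hi' : i < frakC αs idat (k - 1)) :
    ∃ N' M' s', SysInv d αs idat (k + 1) (Fstep αs idat k S).next N' M' s' ∧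
      StepOut d S (Fstep αs idat k S) (αs k) s N' M' s' := by
  obtain ⟨hN, hM, hAo, hBo, hAc, hBc⟩ := h.later hk
  have hAoc := h.FA_o_ne_c hN
  have hBoc := h.FB_o_ne_c hM
  have hlt : ¬ LtK αs k := fun e => by
    obtain ⟨j, hj, hj'⟩ := hk
    simp [e j hj.le] at hj'
  have hK : ¬ IsK αs k := fun e => by
    obtain ⟨j, hj, hj'⟩ := hk
    simp [e.2 j hj] at hj'
  have hini : ¬ ∀ j < k + 1, αs j = false := fun e => by
    obtain ⟨j, hj, hj'⟩ := hk
    simp [e j (by omega)] at hj'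
  have hlev := h.inv.level
  have hfrak := frak_of_gtK (idat := idat) hk
  rw [if_neg hal] at hfrak
  rw [frakC] at hi'
  have hst : Fstep αs idat k S =
      { next := { FA := ⟨S.FA.gr, S.FA.o, S.FA.c⟩,
                  FB := ⟨concatI S.FA.gr S.FB.gr S.FA.c S.FB.c i,
                         Sum.inl S.FA.o, glue S.FA.c S.FB.c S.FB.o⟩ },
        embA := id, embB := glue S.FA.c S.FB.c, crossAB := Sum.inl,
        crossBA := fun _ => S.FA.o } := by
    rw [Fstep, if_neg hlt, if_neg hK, if_neg hal, hid]
    rfl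
  rw [hst, eq_false_of_ne_true hal]
  obtain ⟨x, y, l, hx, hy, hXc, hYc, hcol⟩ := h.exists_nb_c hN hM hAc hBc
  have hZ := concatI_isI h.wfA h.wfB hx hy hXc hYc (by omega) hi' hcol
  have hwf := concatI_wf h.wfA h.wfB hx hy hXc hYc hi'
  have hinv := (hZ.symm.pairInv h.inv.symm).symm
  have hincl := hZ.symm.isInclusion h.inv.symm
  refine ⟨N, M + N - 1, s + N - 1, ⟨h.wfA, hwf, hinv, fun e => absurd e hini, fun _ => ?_⟩,
    stepOut_false (.refl_rev _ _) hincl.2 hincl.1 (fun z => ⟨z, rfl⟩)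
      hZ.surj (by omega) (by omega)⟩
  rw [Nat.add_sub_cancel, hfrak]
  exact ⟨hN, by omega, hAc, (congrArg (· + _) (concatI_idx_glue hBoc)).trans hBo, hAo,
    (congrArg (· + _) (concatI_idx_inl hAoc _)).trans hAo⟩

theorem SysInv.step (hadm : AdmissibleIdx d αs idat) (h : SysInv d αs idat k S N M s) :
    ∃ N' M' s', SysInv d αs idat (k + 1) (Fstep αs idat k S).next N' M' s' ∧
      StepOut d S (Fstep αs idat k S) (αs k) s N' M' s' := by
  obtain ⟨h1, h2, h3⟩ := hadm k
  by_cases hg : GtK αs k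
  · rcases h3 hg with ⟨i, hid, hi, hi'⟩ | ⟨i, j, hid, hi, hi', hj, hj'⟩ <;>
      by_cases hal : αs k = true
    · exact step_of_gtK_one_true h hg hal hid hi hi'
    · exact step_of_gtK_one_false h hg hal hid hi hi'
    · exact step_of_gtK_two_true h hg hal hid hi hi' hj hj'
    · exact step_of_gtK_two_false h hg hal hid hi hi' hj hj'
  · have hf : ∀ j < k, αs j = false := fun j hj => eq_false_of_ne_true fun e => hg ⟨j, hj, e⟩
    by_cases hal : αs k = true
    · rcases h2 ⟨hal, hf⟩ with ⟨i, i', j, hid, hi, hii, hi', hj, hj'⟩ |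
        ⟨hk0, i, j, hid, hi, hi', hj, hj'⟩
      · exact step_of_isK_three h ⟨hal, hf⟩ hid hi hii hi' hj hj'
      · exact step_of_isK_two h ⟨hal, hf⟩ hk0 hid hi hi' hj hj'
    · have hlt : LtK αs k := fun j hj => by
        rcases hj.lt_or_eq with hj | rfl
        · exact hf j hj
        · exact eq_false_of_ne_true hal
      exact step_of_ltK h hlt (h1 hlt)

end

end Sturm

namespace Sturm

/-! ## Types of the vertices above the direct limit -/

theorem IsInclusion.comp {α : Type} {X Y Z : MGraph α} {f : X.Vert → Y.Vert} {g : Y.Vert → Z.Vert}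
    {s t : ℕ} (hg : IsInclusion Y Z g t) (hf : IsInclusion X Y f s) (hst : s ≤ t)
    (hinj : Function.Injective f) : IsInclusion X Z (g ∘ f) s :=
  ⟨fun v n hn => (hg.ty (f v) n (hn.trans hst)).trans (hf.ty v n hn),
    fun u w hne hu => hg.mem _ _ (hinj.ne hne) (hf.mem u w hne hu)⟩

/-- An increasing sequence of chains `F k`, with limit `Q`, and a map `p` to `Q` whose local
degrees are those of the limit. -/
structure LimitCover {α W Q : Type} (d : ℕ) (F : ℕ → MGraph α) (s : ℕ → ℕ)
    (j : ∀ k, (F k).Vert → Q) (col : Q → α) (nb : W → Multiset W) (p : W → Q) : Prop where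
  mono : StrictMono s
  chain : ∀ k, ∃ N pos, Chain (F k) N pos
  card : ∀ k v, ((F k).nb v).card = d
  incl : ∀ k, ∃ f, IsInclusion (F k) (F (k + 1)) f (s k) ∧ ∀ v, j (k + 1) (f v) = j k v
  inj : ∀ k, Function.Injective (j k)
  surj : ∀ y, ∃ k v, j k v = y
  col_eq : ∀ k v, col (j k v) = (F k).col v
  card_nb : ∀ x, (nb x).card = d
  mult_eq : ∀ x y, ∀ᶠ k in Filter.atTop, ∀ v w, j k v = p x → j k w = y →
    mult ((nb x).map p) y = mult ((F k).nb v) w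

namespace LimitCover

variable {α W Q : Type} {d : ℕ} {F : ℕ → MGraph α} {s : ℕ → ℕ} {j : ∀ k, (F k).Vert → Q}
  {col : Q → α} {nb : W → Multiset W} {p : W → Q}

theorem exists_inclusion (h : LimitCover d F s j col nb p) {k m : ℕ} (hkm : k ≤ m) :
    ∃ f, IsInclusion (F k) (F m) f (s k) ∧ ∀ v, j m (f v) = j k v := by
  induction m, hkm using Nat.le_induction with
  | base => exact ⟨id, IsInclusion.refl _ _, fun _ => rfl⟩
  | succ m hkm ih =>
    obtain ⟨f, hf, hfj⟩ := ih
    obtain ⟨g, hg, hgj⟩ := h.incl m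
    have hinj : Function.Injective f := fun u v e =>
      h.inj k ((hfj u).symm.trans ((congrArg (j m) e).trans (hfj v)))
    exact ⟨g ∘ f, hg.comp hf (h.mono.monotone hkm) hinj, fun v => (hgj _).trans (hfj v)⟩

theorem eventually_exists (h : LimitCover d F s j col nb p) (y : Q) :
    ∀ᶠ k in Filter.atTop, ∃ v, j k v = y := by
  obtain ⟨k, v, hv⟩ := h.surj y
  filter_upwards [Filter.eventually_ge_atTop k] with m hm
  obtain ⟨f, -, hf⟩ := h.exists_inclusion hm
  exact ⟨f v, (hf v).trans hv⟩

/-- The neighbors of a vertex lie above the neighbors of its image. -/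
theorem eventually_map_nb (h : LimitCover d F s j col nb p) (x : W) :
    ∀ᶠ k in Filter.atTop, ∀ v, j k v = p x → (nb x).map p = ((F k).nb v).map (j k) := by
  have h1 : ∀ᶠ k in Filter.atTop, ∀ z ∈ (nb x).toFinset, (∃ w, j k w = p z) ∧
      ∀ v w, j k v = p x → j k w = p z → mult ((nb x).map p) (p z) = mult ((F k).nb v) w :=
    (Filter.eventually_all_finset _).2 fun z _ =>
      (h.eventually_exists (p z)).and (h.mult_eq x (p z))
  filter_upwards [h1] with k hk v hv
  refine Multiset.eq_of_le_of_card_le (Multiset.le_iff_count.2 fun y => ?_) ?_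
  · by_cases hy : y ∈ (nb x).map p
    · obtain ⟨z, hz, rfl⟩ := Multiset.mem_map.1 hy
      obtain ⟨⟨w, hw⟩, hk⟩ := hk z (Multiset.mem_toFinset.2 hz)
      have h2 := hk v w hv hw
      rw [← mult_map (h.inj k), hw] at h2
      exact h2.le
    · rw [Multiset.count_eq_zero_of_notMem hy]
      exact Nat.zero_le _
  · rw [Multiset.card_map, Multiset.card_map, h.card, h.card_nb]

theorem eventually_nbType_eq (h : LimitCover d F s j col nb p) (n : ℕ) (x : W) :
    ∀ᶠ k in Filter.atTop, ∀ v, j k v = p x → nbType nb (col ∘ p) n x = (F k).ty n v := by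
  induction n generalizing x with
  | zero => exact Filter.Eventually.of_forall fun _ _ _ => rfl
  | succ n ih =>
    have h1 : ∀ᶠ k in Filter.atTop, ∀ z ∈ (nb x).toFinset, ∀ v, j k v = p z →
        nbType nb (col ∘ p) n z = (F k).ty n v :=
      (Filter.eventually_all_finset _).2 fun z _ => ih z
    filter_upwards [h1, h.eventually_map_nb x] with k hk hmap v hv
    refine nbType_succ_eq.2 ⟨?_, ?_⟩
    · rw [Function.comp_apply, ← hv, h.col_eq]
    · rw [← Multiset.rel_eq, Multiset.rel_map]
      have h2 := hmap v hv
      rw [← Multiset.rel_eq, Multiset.rel_map] at h2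
      exact h2.mono fun z hz w _ e => hk z (Multiset.mem_toFinset.2 hz) w e.symm

theorem mem_range_of_mem_nb (h : LimitCover d F s j col nb p) {k : ℕ} {u w : (F k).Vert}
    (hne : u ≠ w) (hu : u ∈ (F k).nb w) (hw : j k w ∈ Set.range p) : j k u ∈ Set.range p := by
  obtain ⟨x, hx⟩ := hw
  obtain ⟨m, hm, hkm⟩ := ((h.mult_eq x (j k u)).and (Filter.eventually_ge_atTop k)).exists
  obtain ⟨f, hf, hfj⟩ := h.exists_inclusion hkm
  have h1 := hm (f w) (f u) ((hfj w).trans hx.symm) (hfj u)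
  have h2 : 0 < mult ((nb x).map p) (j k u) := by
    rw [h1]
    exact Multiset.count_pos.2 (hf.mem u w hne hu)
  obtain ⟨z, -, hz⟩ := Multiset.mem_map.1 (Multiset.count_pos.1 h2)
  exact ⟨z, hz⟩

theorem mem_range_iff (h : LimitCover d F s j col nb p) {k : ℕ} (u : (F k).Vert) :
    j k u ∈ Set.range p ↔ j k (F k).c ∈ Set.range p := by
  obtain ⟨N, pos, hpos⟩ := h.chain k
  obtain ⟨n, hn⟩ : ∃ n, pos u = n := ⟨_, rfl⟩
  induction n generalizing u with
  | zero => rw [hpos.inj (hn.trans hpos.pos_c.symm)]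
  | succ n ih =>
    obtain ⟨w, hw⟩ := hpos.surj n (by have := hpos.lt u; omega)
    have hne : u ≠ w := by
      rintro rfl
      omega
    have h1 := hpos.adj u w (by omega)
    rw [← ih w hw]
    exact ⟨h.mem_range_of_mem_nb hne.symm h1.2, h.mem_range_of_mem_nb hne h1.1⟩

theorem surjective [Nonempty W] (h : LimitCover d F s j col nb p) : Function.Surjective p := by
  intro y
  obtain ⟨x⟩ := ‹Nonempty W›
  obtain ⟨k, ⟨v, hv⟩, u, hu⟩ := ((h.eventually_exists y).and (h.eventually_exists (p x))).exists
  have h1 := (h.mem_range_iff u).1 ⟨x, hu.symm⟩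
  rw [← h.mem_range_iff v, hv] at h1
  exact h1

theorem range_ty_subset [Nonempty W] (h : LimitCover d F s j col nb p) (k : ℕ) :
    Set.range ((F k).ty (s k)) ⊆ Set.range (nbType nb (col ∘ p) (s k)) := by
  rintro _ ⟨v, rfl⟩
  obtain ⟨x, hx⟩ := h.surjective (j k v)
  obtain ⟨m, hm, hkm⟩ :=
    ((h.eventually_nbType_eq (s k) x).and (Filter.eventually_ge_atTop k)).exists
  obtain ⟨f, hf, hfj⟩ := h.exists_inclusion hkm
  exact ⟨x, (hm (f v) ((hfj v).trans hx.symm)).trans (hf.ty v _ le_rfl)⟩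

theorem range_nbType_subset (h : LimitCover d F s j col nb p) {n k : ℕ} {T : Set (NbType α n)}
    (hT : ∀ m, k ≤ m → ∀ v, (F m).ty n v ∈ T) : Set.range (nbType nb (col ∘ p) n) ⊆ T := by
  rintro _ ⟨x, rfl⟩
  obtain ⟨m, ⟨hm, v, hv⟩, hkm⟩ := (((h.eventually_nbType_eq n x).and
    (h.eventually_exists (p x))).and (Filter.eventually_ge_atTop k)).exists
  rw [hm v hv]
  exact hT m hkm v

end LimitCover

theorem PairInv.ncard_union_range_ty {α : Type} {d N M s : ℕ} {X Y : MGraph α}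
    (h : PairInv d X Y N M s) :
    (Set.range (X.ty s) ∪ Set.range (Y.ty s)).Finite ∧
      (Set.range (X.ty s) ∪ Set.range (Y.ty s)).ncard ≤ s + 1 := by
  obtain ⟨_, hX⟩ := h.chX
  obtain ⟨_, hY⟩ := h.chY
  have := hX.finite
  have := hY.finite
  have fX := Set.finite_range (X.ty s)
  have fY := Set.finite_range (Y.ty s)
  refine ⟨fX.union fY, ?_⟩
  have h1 := Set.ncard_union_add_ncard_inter _ _ fX fY
  have h2 : 0 < (Set.range (X.ty s) ∩ Set.range (Y.ty s)).ncard :=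
    (Set.ncard_pos (fX.inter_of_left _)).2
      ⟨X.ty s X.c, ⟨_, rfl⟩, ⟨Y.c, ((h.sep _ _).2 ⟨rfl, rfl⟩).symm⟩⟩
  have h3 : (Set.range (X.ty s)).ncard = N := by
    rw [← Set.image_univ, Set.ncard_image_of_injective _ h.injX, Set.ncard_univ, hX.ncard]
  have h4 : (Set.range (Y.ty s)).ncard = M := by
    rw [← Set.image_univ, Set.ncard_image_of_injective _ h.injY, Set.ncard_univ, hY.ncard]
  have h5 := h.level
  omega

/-- The invariants hold for the whole sequence of pairs. -/
theorem exists_sysInv {V α : Type} {a b : α} (hab : a ≠ b) {d : ℕ} {αs : ℕ → Bool}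
    {idat : ℕ → IdxData} (hadm : AdmissibleIdx d αs idat) :
    ∃ N M s : ℕ → ℕ, ∀ k, SysInv d αs idat (k + 1) (Fsys V α a b d αs idat k) (N k) (M k) (s k) ∧
      StepOut d (Fsys V α a b d αs idat k) (Fstep αs idat (k + 1) (Fsys V α a b d αs idat k))
        (αs (k + 1)) (s k) (N (k + 1)) (M (k + 1)) (s (k + 1)) := by
  obtain ⟨N0, M0, s0, h0, -⟩ := (baseSys_inv (V := V) hab (d := d) αs idat).step hadm
  choose! N1 M1 s1 h1 h2 using fun k N M s
    (h : SysInv d αs idat (k + 1) (Fsys V α a b d αs idat k) N M s) => h.step hadm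
  let r : ℕ → ℕ × ℕ × ℕ := fun k => Nat.rec (N0, M0, s0)
    (fun k q => (N1 k q.1 q.2.1 q.2.2, M1 k q.1 q.2.1 q.2.2, s1 k q.1 q.2.1 q.2.2)) k
  have hr : ∀ k, SysInv d αs idat (k + 1) (Fsys V α a b d αs idat k) (r k).1 (r k).2.1 (r k).2.2 :=
    fun k => by
      induction k with
      | zero => exact h0
      | succ k ih => exact h1 k _ _ _ ih
  exact ⟨fun k => (r k).1, fun k => (r k).2.1, fun k => (r k).2.2,
    fun k => ⟨hr k, h2 k _ _ _ (hr k)⟩⟩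

section

variable {V α : Type} {a b : α} {d : ℕ} {αs : ℕ → Bool} {idat : ℕ → IdxData}
  {k N M s : ℕ} {S : Sys V α}

theorem SysInv.exists_chain (h : SysInv d αs idat k S N M s) (x : Bool) :
    ∃ pos, Chain (Fside S x).mg (if x = true then N else M) pos := by
  cases x
  · exact h.inv.chY
  · exact h.inv.chX

theorem SysInv.wf (h : SysInv d αs idat k S N M s) (x : Bool) : (Fside S x).gr.WF := by
  cases x
  · exact h.wfB
  · exact h.wfA

theorem SysInv.card_nb (h : SysInv d αs idat k S N M s) (x : Bool) (v : (Fside S x).mg.Vert) :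
    ((Fside S x).mg.nb v).card = d := by
  cases x
  · exact h.inv.cardY v
  · exact h.inv.cardX v

theorem SysInv.ty_injective (h : SysInv d αs idat k S N M s) (x : Bool) :
    Function.Injective ((Fside S x).mg.ty s) := by
  cases x
  · exact h.inv.injY
  · exact h.inv.injX

/-- The types, of depth `n`, of the vertices of the two sides of a system. -/
def Sys.types (S : Sys V α) (n : ℕ) : Set (NbType α n) :=
  Set.range (S.FA.mg.ty n) ∪ Set.range (S.FB.mg.ty n)

theorem Sys.mem_types {S : Sys V α} {n : ℕ} {t : NbType α n} :
    t ∈ S.types n ↔ ∃ x v, (Fside S x).mg.ty n v = t := by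
  constructor
  · rintro (⟨v, hv⟩ | ⟨v, hv⟩)
    · exact ⟨true, v, hv⟩
    · exact ⟨false, v, hv⟩
  · rintro ⟨x | x, v, hv⟩
    · exact Or.inr ⟨v, hv⟩
    · exact Or.inl ⟨v, hv⟩

theorem types_mono {s N M : ℕ → ℕ} (hs : StrictMono s)
    (hout : ∀ k, StepOut d (Fsys V α a b d αs idat k)
      (Fstep αs idat (k + 1) (Fsys V α a b d αs idat k))
      (αs (k + 1)) (s k) (N (k + 1)) (M (k + 1)) (s (k + 1))) {k m : ℕ} (hkm : k ≤ m) {n : ℕ}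
    (hn : n ≤ s k) :
    (Fsys V α a b d αs idat m).types n ⊆ (Fsys V α a b d αs idat k).types n := by
  induction m, hkm using Nat.le_induction with
  | base => exact subset_rfl
  | succ m hkm ih =>
    refine subset_trans ?_ ih
    intro t ht
    obtain ⟨y, v, hv⟩ := Sys.mem_types.1 ht
    obtain ⟨x, u, hu⟩ := (hout m).cover y v
    exact Sys.mem_types.2 ⟨x, u, (hu n (hn.trans (hs.monotone hkm))).trans hv⟩

theorem mult_map_graphNb {W Q : Type} {H : SimpleGraph W} (hH : IsRegularTree H d) (hd : 0 < d)
    (p : W → Q) (x : W) (y : Q) :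
    mult ((graphNb H x).map p) y = (H.neighborSet x ∩ p ⁻¹' {y}).ncard := by
  have h : H.neighborSet x ∩ p ⁻¹' {y} =
      ((hH.finite_neighborSet hd x).toFinset.filter fun z => y = p z) := by
    ext z
    simp [eq_comm]
  rw [h, Set.ncard_coe_finset, mult, Multiset.count_map, graphNb,
    dif_pos (hH.finite_neighborSet hd x)]
  rfl

end

theorem limitCover_of_isDirLimit {V α : Type} {a b : α} {d : ℕ} (hd : 0 < d)
    {αs βs : ℕ → Bool} {idat : ℕ → IdxData} (hβ : AdmissibleBeta αs βs) {s N M : ℕ → ℕ}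
    (hinv : ∀ k, SysInv d αs idat (k + 1) (Fsys V α a b d αs idat k) (N k) (M k) (s k))
    (hout : ∀ k, StepOut d (Fsys V α a b d αs idat k)
      (Fstep αs idat (k + 1) (Fsys V α a b d αs idat k))
      (αs (k + 1)) (s k) (N (k + 1)) (M (k + 1)) (s (k + 1)))
    {Y : EIG V α}
    (hY : IsDirLimit (Fbeta V α a b d αs idat βs) (betaEmb V α a b d αs idat βs) Y)
    {W : Type} {H : SimpleGraph W} (hH : IsRegularTree H d)
    {p : W → Y.Vert} (hp : IsEIGCover H Y p) :
    ∃ j, LimitCover d (fun k => (Fside (Fsys V α a b d αs idat k) (βs k)).mg) s j Y.col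
      (graphNb H) p := by
  obtain ⟨j, hι, hinj, hsurj, hcol, hidx⟩ := hY
  refine ⟨j, ?_⟩
  exact
    { mono := strictMono_nat_of_lt_succ fun k => (hout k).lt
      chain := fun k => ⟨_, (hinv k).exists_chain (βs k)⟩
      card := fun k v => (hinv k).card_nb (βs k) v
      incl := fun k => ⟨_, (hout k).side (βs k) (βs (k + 1)) (hβ k).symm, hι k⟩
      inj := hinj
      surj := hsurj
      col_eq := hcol
      card_nb := fun x => hH.card_graphNb hd x
      mult_eq := fun x y => by
        obtain ⟨K, hK⟩ := hidx (p x) y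
        filter_upwards [Filter.eventually_ge_atTop K] with k hk v w hv hw
        rw [mult_map_graphNb hH hd, hp x y, hK k hk v w hv hw]
        exact (((hinv k).wf (βs k)).mult_nb v w).symm }

end Sturm

namespace Sturm

/-- Proposition 4.7: for any sequence `α_k`, any `α_k`-admissible
sequence of index data `i_k` and any `α_k`-admissible sequence `β_k` with `β_k = α_k`
infinitely often, the vertex coloring of the `d`-regular tree obtained by pulling back,
along the universal covering, the coloring of the direct limit `Y = lim F^{β_k}_k`
(taken along the natural inclusions) is a Sturmian coloring. -/
theorem direct_limit_is_sturmian {V α : Type} (a b : α) (hab : a ≠ b)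
    (d : ℕ) (hd : 3 ≤ d)
    (αs : ℕ → Bool) (idat : ℕ → IdxData) (hadm : AdmissibleIdx d αs idat)
    (βs : ℕ → Bool) (hβ : AdmissibleBeta αs βs)
    (hinf : ∀ N, ∃ k, N ≤ k ∧ βs k = αs k)
    (Y : EIG V α)
    (hY : IsDirLimit (Fbeta V α a b d αs idat βs) (betaEmb V α a b d αs idat βs) Y)
    {W : Type} (H : SimpleGraph W) (hH : IsRegularTree H d)
    (p : W → Y.Vert) (hp : IsEIGCover H Y p) :
    IsSturmian H (Y.col ∘ p) := by
  have hd0 : 0 < d := by omega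
  obtain ⟨N, M, s, hNMs⟩ := exists_sysInv (V := V) hab hadm
  have hinv := fun k => (hNMs k).1
  have hout := fun k => (hNMs k).2
  obtain ⟨j, hj⟩ := limitCover_of_isDirLimit hd0 hβ hinv hout hY hH hp
  have : Nonempty W := hH.isTree.connected.nonempty
  have hsub : ∀ k, Set.range (nbType (graphNb H) (Y.col ∘ p) (s k)) ⊆
      (Fsys V α a b d αs idat k).types (s k) := fun k =>
    hj.range_nbType_subset (k := k) fun m hkm v =>
      types_mono hj.mono hout hkm le_rfl (Sys.mem_types.2 ⟨βs m, v, rfl⟩)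
  have hbound := fun k => (hinv k).inv.ncard_union_range_ty
  have hfin := fun k => (hbound k).1.subset (hsub k)
  intro n
  rw [ncard_ballClasses hH hd0]
  refine ncard_range_nbType (fun n => ⟨s n, hj.mono.le_apply, hfin n,
    (Set.ncard_le_ncard (hsub n) (hbound n).1).trans (hbound n).2⟩) (fun C => ?_) (n + 1)
  obtain ⟨k, hk, hβk⟩ := hinf (C + 1)
  obtain ⟨k, rfl⟩ : ∃ l, k = l + 1 := ⟨k - 1, by omega⟩
  refine ⟨s (k + 1), ?_⟩
  obtain ⟨pos, hpos⟩ := (hinv (k + 1)).exists_chain (βs (k + 1))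
  have h1 := Set.ncard_le_ncard (hj.range_ty_subset (k + 1)) (hfin (k + 1))
  have h2 := (hout k).big
  rw [← hβk, ← hpos.ncard, ← Set.ncard_univ,
    ← Set.ncard_image_of_injective _ ((hinv (k + 1)).ty_injective (βs (k + 1))),
    Set.image_univ] at h2
  have h3 := hj.mono.le_apply (x := k)
  exact le_trans (by omega) (h2.trans h1)

end Sturm
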